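/- Let E be an archimedean spectral effect algebra and a ∈ E. Then for every λ ∈ [0,1]∩ℚ, the rational spectral projection p^C_{a,λ} does not depend on the C-block C containing a, and p^C_{a,λ} = ⋀{p_{a,μ} : μ dyadic rational in [0,1], μ > λ} =: p_{a,λ}; the resulting family {p_{a,λ}}_{λ∈ℚ∩[0,1]} is called the rational spectral resolution of a. -/

import Mathlib

/- Common definitions: effect algebras, compression bases, spectrality -/

attribute [local instance 0] Classical.propDecidable

universe u

structure EffectAlgebra (E : Type u) where
  padd : E → E → Option E
  zero : E
  one : E
  comm : ∀ a b, padd a b = padd b a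
  assoc : ∀ a b c ab abc, padd a b = some ab → padd ab c = some abc →
      ∃ bc, padd b c = some bc ∧ padd a bc = some abc
  orth_exists : ∀ a, ∃ x, padd a x = some one
  orth_unique : ∀ a x y, padd a x = some one → padd a y = some one → x = y
  add_one : ∀ a b, padd a one = some b → a = zero

namespace EffectAlgebra

variable {E : Type u} (EA : EffectAlgebra E)

/-- `a ⊥ b` and `a ⊕ b = c`. -/
def le (a b : E) : Prop := ∃ c, EA.padd a c = some b

/-- the orthosupplement `a'`. -/
noncomputable def compl (a : E) : E := (EA.orth_exists a).choose

/-- `b ⊖ a` (the element `c` with `a ⊕ c = b`, when it exists). -/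
noncomputable def osub (b a : E) : E :=
  if h : ∃ c, EA.padd a c = some b then h.choose else EA.zero

/-- the value of `a ⊕ b` (defaulting to `0` when undefined). -/
noncomputable def oplusD (a b : E) : E := (EA.padd a b).getD EA.zero

def IsSharp (a : E) : Prop := ∀ x, EA.le x a → EA.le x (EA.compl a) → x = EA.zero

/-- sub-effect algebra. -/
def SubEA (P : Set E) : Prop :=
  EA.zero ∈ P ∧ EA.one ∈ P ∧ (∀ a ∈ P, EA.compl a ∈ P) ∧
    ∀ a ∈ P, ∀ b ∈ P, ∀ c, EA.padd a b = some c → c ∈ P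

/-- Mackey compatibility: `a = a₁ ⊕ c`, `b = b₁ ⊕ c` with `a₁ ⊕ b₁ ⊕ c` defined. -/
def Mackey (a b : E) : Prop :=
  ∃ a1 b1 c d e, EA.padd a1 b1 = some d ∧ EA.padd d c = some e ∧
    EA.padd a1 c = some a ∧ EA.padd b1 c = some b

def Additive (J : E → E) : Prop :=
  ∀ a b c, EA.padd a b = some c → EA.padd (J a) (J b) = some (J c)

def Retraction (J : E → E) : Prop :=
  EA.Additive J ∧ ∀ a, EA.le a (J EA.one) → J a = a

def Compression (J : E → E) : Prop :=
  EA.Retraction J ∧ ∀ a, (J a = EA.zero ↔ EA.le a (EA.compl (J EA.one)))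

/-- `I` is a supplement of `J`: `Ker J = ran I` and `Ker I = ran J`. -/
def Supplement (I J : E → E) : Prop :=
  (∀ a, J a = EA.zero ↔ ∃ b, I b = a) ∧ (∀ a, I a = EA.zero ↔ ∃ b, J b = a)

/-- the `n`-fold sum `n·a`, when defined. -/
def nsmulE : ℕ → E → Option E
  | 0, _ => some EA.zero
  | n + 1, a => (nsmulE n a).bind fun b => EA.padd a b

def ArchimedeanEA : Prop :=
  ∀ a : E, (∀ n : ℕ, ∃ b, EA.nsmulE n a = some b) → a = EA.zero

/-- a state on an effect algebra. -/
def IsState (s : E → ℝ) : Prop :=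
  s EA.one = 1 ∧ (∀ a, 0 ≤ s a ∧ s a ≤ 1) ∧
    ∀ a b c, EA.padd a b = some c → s c = s a + s b

noncomputable def partialSum (f : ℕ → E) : ℕ → E
  | 0 => EA.zero
  | n + 1 => EA.oplusD (partialSum f n) (f n)

/-- σ-additivity of a state: if all partial sums of an orthogonal sequence are defined
and the orthosum (= supremum of the partial sums) exists, the state is countably additive. -/
def SigmaAdditive (s : E → ℝ) : Prop :=
  ∀ f : ℕ → E, ∀ b : E,
    (∀ n, ∃ c, EA.padd (EA.partialSum f n) (f n) = some c) →
    (∀ n, EA.le (EA.partialSum f n) b) →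
    (∀ c, (∀ n, EA.le (EA.partialSum f n) c) → EA.le b c) →
    Filter.Tendsto (fun n => ∑ i ∈ Finset.range n, s (f i)) Filter.atTop (nhds (s b))

/-- A compression base: a family of compressions indexed by a sub-effect algebra `P`
such that each `p ∈ P` is the focus of `J p`, and Mackey compatible projections
compose to a projection. -/
structure CompressionBase {E : Type u} (EA : EffectAlgebra E) where
  P : Set E
  J : E → E → E
  sub : EA.SubEA P
  compr : ∀ p ∈ P, EA.Compression (J p)
  focus : ∀ p ∈ P, J p EA.one = p
  mackey : ∀ p ∈ P, ∀ q ∈ P, EA.Mackey p q → ∃ r ∈ P, J p ∘ J q = J r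

variable (CB : CompressionBase EA)

/-- `a ∈ C(p)`:  `a = J_p(a) ⊕ J_{p'}(a)`. -/
def inC (a p : E) : Prop :=
  EA.padd (CB.J p a) (CB.J (EA.compl p) a) = some a

/-- `PC(a) = {p ∈ P : a ∈ C(p)}`. -/
def PC (a : E) : Set E := {p | p ∈ CB.P ∧ inC EA CB a p}

/-- the bicommutant `P(a)`. -/
def bicomm (a : E) : Set E :=
  {p | p ∈ PC EA CB a ∧ ∀ q ∈ PC EA CB a, inC EA CB p q}

/-- `PC(A)` for a set `A ⊆ E`. -/
def PCset (A : Set E) : Set E := {p | p ∈ CB.P ∧ ∀ a ∈ A, inC EA CB a p}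

/-- `P(Q) = PC(PC(Q) ∪ Q)`. -/
def Pset (Q : Set E) : Set E := PCset EA CB (PCset EA CB Q ∪ Q)

/-- `P_≤(e,f)`. -/
def Ple (e f : E) : Set E :=
  {p | p ∈ Pset EA CB {e, f} ∧ EA.le (CB.J p e) (CB.J p f) ∧
    EA.le (CB.J (EA.compl p) f) (CB.J (EA.compl p) e)}

/-- a Boolean subalgebra of `P`: a sub-effect algebra of `E` contained in `P`
whose elements are pairwise Mackey compatible, with witnesses inside. -/
def BooleanSub (B : Set E) : Prop :=
  B ⊆ CB.P ∧ EA.SubEA B ∧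
    ∀ p ∈ B, ∀ q ∈ B, ∃ p1 ∈ B, ∃ q1 ∈ B, ∃ c ∈ B, ∃ d e,
      EA.padd p1 q1 = some d ∧ EA.padd d c = some e ∧
      EA.padd p1 c = some p ∧ EA.padd q1 c = some q

/-- `a` is a b-element with associated Boolean subalgebra `B`. -/
def IsBElementWith (a : E) (B : Set E) : Prop :=
  BooleanSub EA CB B ∧ ∀ p ∈ CB.P, (inC EA CB a p ↔ ∀ b ∈ B, inC EA CB b p)

def IsBElement (a : E) : Prop := ∃ B, IsBElementWith EA CB a B

def BProperty : Prop := ∀ a : E, IsBElement EA CB a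

/-- commuting of b-elements: `e C f` iff `P(e) ↔ P(f)`. -/
def CommuteEl (e f : E) : Prop :=
  ∀ p ∈ bicomm EA CB e, ∀ q ∈ bicomm EA CB f, EA.Mackey p q

def BComparability : Prop :=
  BProperty EA CB ∧ ∀ e f : E, CommuteEl EA CB e f → (Ple EA CB e f).Nonempty

def IsProjCover (a p : E) : Prop :=
  p ∈ CB.P ∧ ∀ q ∈ CB.P, (EA.le a q ↔ EA.le p q)

def ProjCoverProp : Prop := ∀ a : E, ∃ p, IsProjCover EA CB a p

def Spectral : Prop := ProjCoverProp EA CB ∧ BComparability EA CB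

/-- a block of `P`: a maximal set of pairwise Mackey compatible projections. -/
def IsBlock (B : Set E) : Prop :=
  B ⊆ CB.P ∧ (∀ p ∈ B, ∀ q ∈ B, EA.Mackey p q) ∧
    ∀ B' : Set E, B' ⊆ CB.P → (∀ p ∈ B', ∀ q ∈ B', EA.Mackey p q) → B ⊆ B' → B' = B

/-- the C-block `C(B)`. -/
def Cblock (B : Set E) : Set E := {a | ∀ p ∈ B, inC EA CB a p}

/-- `(f − e)_+` (the positive part, defined when `P_≤(e,f)` is nonempty). -/
noncomputable def posPart (e f : E) : E :=
  if h : (Ple EA CB e f).Nonempty then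
    EA.osub (CB.J h.some f) (CB.J h.some e)
  else EA.zero

noncomputable def projCover (a : E) : E :=
  if h : ∃ p, IsProjCover EA CB a p then h.choose else EA.zero

def IsMeetP (p q m : E) : Prop :=
  m ∈ CB.P ∧ EA.le m p ∧ EA.le m q ∧ ∀ s ∈ CB.P, EA.le s p → EA.le s q → EA.le s m

/-- `p ∧ q` in `P`. -/
noncomputable def pmeet (p q : E) : E :=
  if h : ∃ m, IsMeetP EA CB p q m then h.choose else EA.zero

/-- infimum of a set of projections in `P`. -/
def IsInfP (S : Set E) (m : E) : Prop :=
  m ∈ CB.P ∧ (∀ s ∈ S, EA.le m s) ∧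
    ∀ t ∈ CB.P, (∀ s ∈ S, EA.le t s) → EA.le t m

/-! Relative (to a projection `q`, i.e. computed in the interval `[0,q]`) notions. -/

def Pq (q : E) : Set E := {p | p ∈ CB.P ∧ EA.le p q}

def inCq (q a p : E) : Prop :=
  EA.padd (CB.J p a) (CB.J (EA.osub q p) a) = some a

def PCq (q a : E) : Set E := {p | p ∈ Pq EA CB q ∧ inCq EA CB q a p}

def bicommq (q a : E) : Set E :=
  {p | p ∈ PCq EA CB q a ∧ ∀ r ∈ PCq EA CB q a, inCq EA CB q p r}

def PCsetq (q : E) (A : Set E) : Set E :=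
  {p | p ∈ Pq EA CB q ∧ ∀ a ∈ A, inCq EA CB q a p}

def Psetq (q : E) (Q : Set E) : Set E := PCsetq EA CB q (PCsetq EA CB q Q ∪ Q)

def Pleq (q e f : E) : Set E :=
  {p | p ∈ Psetq EA CB q {e, f} ∧ EA.le (CB.J p e) (CB.J p f) ∧
    EA.le (CB.J (EA.osub q p) f) (CB.J (EA.osub q p) e)}

noncomputable def posPartq (q e f : E) : E :=
  if h : (Pleq EA CB q e f).Nonempty then
    EA.osub (CB.J h.some f) (CB.J h.some e)
  else EA.zero

def IsProjCoverq (q a p : E) : Prop :=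
  p ∈ Pq EA CB q ∧ ∀ s ∈ Pq EA CB q, (EA.le a s ↔ EA.le p s)

noncomputable def projCoverq (q a : E) : E :=
  if h : ∃ p, IsProjCoverq EA CB q a p then h.choose else EA.zero

def Mackeyq (q a b : E) : Prop :=
  ∃ a1 b1 c d e, EA.padd a1 b1 = some d ∧ EA.padd d c = some e ∧ EA.le e q ∧
    EA.padd a1 c = some a ∧ EA.padd b1 c = some b

def SubEAq (q : E) (F : Set E) : Prop :=
  EA.zero ∈ F ∧ q ∈ F ∧ (∀ x ∈ F, EA.osub q x ∈ F) ∧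
    ∀ x ∈ F, ∀ y ∈ F, ∀ z, EA.padd x y = some z → EA.le z q → z ∈ F

def BooleanSubq (q : E) (B : Set E) : Prop :=
  B ⊆ Pq EA CB q ∧ SubEAq EA q B ∧
    ∀ p ∈ B, ∀ r ∈ B, ∃ p1 ∈ B, ∃ r1 ∈ B, ∃ c ∈ B, ∃ d e,
      EA.padd p1 r1 = some d ∧ EA.padd d c = some e ∧ EA.le e q ∧
      EA.padd p1 c = some p ∧ EA.padd r1 c = some r

def IsBElementq (q a : E) : Prop :=
  ∃ B, BooleanSubq EA CB q B ∧
    ∀ p ∈ Pq EA CB q, (inCq EA CB q a p ↔ ∀ b ∈ B, inCq EA CB q b p)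

def BPropertyq (q : E) : Prop := ∀ a : E, EA.le a q → IsBElementq EA CB q a

def CommuteElq (q e f : E) : Prop :=
  ∀ p ∈ bicommq EA CB q e, ∀ r ∈ bicommq EA CB q f, Mackeyq EA q p r

def BComparabilityq (q : E) : Prop :=
  BPropertyq EA CB q ∧ ∀ e f : E, EA.le e q → EA.le f q →
    CommuteElq EA CB q e f → (Pleq EA CB q e f).Nonempty

/-! The binary spectral resolution. -/

/-- `λ(w) = Σ_j w_j 2^{-j}` (head of the list is the first digit). -/
def lamOf : List Bool → ℚ
  | [] => 0
  | b :: t => ((if b then 1 else 0) + lamOf t) / 2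

/-- all binary strings of length `n`, in lexicographic order. -/
def allStrings : ℕ → List (List Bool)
  | 0 => [[]]
  | n + 1 => (allStrings n).flatMap fun w => [w ++ [false], w ++ [true]]

noncomputable def listSum (l : List E) : E :=
  l.foldl (fun acc x => EA.oplusD acc x) EA.zero

/-- the families `(u_w, c_w)`; the binary string is given in reversed order
(head of the list is the last digit). -/
noncomputable def ucAux (a : E) : List Bool → E × E
  | [] => (projCover EA CB a, a)
  | bit :: t =>
      let p := ucAux a t
      let q := p.1
      let cw := p.2
      let cw' := EA.osub q cw
      let d := posPartq EA CB q cw' cw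
      let u0 := pmeet EA CB (EA.osub q (projCoverq EA CB q d)) q
      if bit then (pmeet EA CB q (EA.compl u0), d)
      else (u0, EA.oplusD (CB.J u0 cw) (CB.J u0 cw))

noncomputable def uw (a : E) (w : List Bool) : E := (ucAux EA CB a w.reverse).1

noncomputable def cw (a : E) (w : List Bool) : E := (ucAux EA CB a w.reverse).2

/-- the binary spectral projection `p_{a,λ(w1)}`. -/
noncomputable def pbin (a : E) (w : List Bool) : E :=
  listSum EA (EA.compl (projCover EA CB a) ::
    (((allStrings (w.length + 1)).filter
        fun v => lamOf v ≤ lamOf (w ++ [false])).map (uw EA CB a)))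

def Dyadic01 (x : ℚ) : Prop := ∃ n k : ℕ, (k : ℚ) ≤ 2 ^ n ∧ x = (k : ℚ) / 2 ^ n

/-- the binary spectral resolution `p_{a,λ}`, for dyadic rationals `λ ∈ [0,1]`. -/
noncomputable def pdyad (a : E) (x : ℚ) : E :=
  if x ≤ 0 then EA.compl (projCover EA CB a)
  else if 1 ≤ x then EA.one
  else if h : ∃ w : List Bool, lamOf (w ++ [true]) = x then pbin EA CB a h.choose
  else EA.zero

/-- the rational spectral resolution `p_{a,λ} = ⋀_{μ > λ, μ dyadic} p_{a,μ}`. -/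
noncomputable def ratRes (a : E) (x : ℚ) : E :=
  if h : ∃ m, IsInfP EA CB {y | ∃ μ, Dyadic01 μ ∧ x < μ ∧ y = pdyad EA CB a μ} m
  then h.choose else EA.zero

/-- the partial maps `f_0(b) = 2b`, `f_1(b) = (2b')'` computed in `[0,uu]`. -/
noncomputable def fstep (uu b : E) (bit : Bool) : Option E :=
  if bit then
    (if EA.le (EA.osub uu b) b
      then some (EA.osub uu (EA.oplusD (EA.osub uu b) (EA.osub uu b))) else none)
  else
    (if EA.le b (EA.osub uu b) then some (EA.oplusD b b) else none)

/-- `f_w = f_{w_n} ∘ ⋯ ∘ f_{w_1}`, computed in `[0,uu]`, as a partial map. -/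
noncomputable def fword (uu : E) (w : List Bool) (b : E) : Option E :=
  w.foldl (fun ob bit => ob.bind fun x => fstep EA uu x bit) (some b)

end EffectAlgebra


namespace EffectAlgebra

section Basics

variable {E : Type u} (EA : EffectAlgebra E)

theorem zero_add_one' : EA.padd EA.one EA.zero = some EA.one := by
  obtain ⟨x, hx⟩ := EA.orth_exists EA.one
  have h := hx
  rw [EA.comm] at h
  have := EA.add_one _ _ h
  rw [this] at hx
  exact hx

theorem compl_spec (a : E) : EA.padd a (EA.compl a) = some EA.one :=
  (EA.orth_exists a).choose_spec

theorem compl_uniq {a x : E} (h : EA.padd a x = some EA.one) : x = EA.compl a :=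
  EA.orth_unique _ _ _ h (EA.compl_spec a)

theorem compl_spec' (a : E) : EA.padd (EA.compl a) a = some EA.one := by
  rw [EA.comm]; exact EA.compl_spec a

theorem compl_compl (a : E) : EA.compl (EA.compl a) = a :=
  (EA.compl_uniq (EA.compl_spec' a)).symm

theorem padd_zero (a : E) : EA.padd a EA.zero = some a := by
  obtain ⟨bc, h1, h2⟩ := EA.assoc _ _ _ _ _ (EA.compl_spec' a) EA.zero_add_one'
  have := EA.compl_uniq h2
  rw [EA.compl_compl] at this
  rw [h1, this]

theorem zero_padd (a : E) : EA.padd EA.zero a = some a := by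
  rw [EA.comm]; exact EA.padd_zero a

theorem assoc' {a b c bc abc : E} (h1 : EA.padd b c = some bc) (h2 : EA.padd a bc = some abc) :
    ∃ ab, EA.padd a b = some ab ∧ EA.padd ab c = some abc := by
  rw [EA.comm] at h1 h2
  obtain ⟨x, hx, hy⟩ := EA.assoc _ _ _ _ _ h1 h2
  rw [EA.comm] at hx hy
  exact ⟨x, hx, hy⟩

theorem cancel {a b b2 c : E} (h1 : EA.padd a b = some c) (h2 : EA.padd a b2 = some c) :
    b = b2 := by
  rw [EA.comm] at h1 h2
  obtain ⟨z, hz, hb⟩ := EA.assoc _ _ _ _ _ h1 (EA.compl_spec c)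
  obtain ⟨z2, hz2, hb2⟩ := EA.assoc _ _ _ _ _ h2 (EA.compl_spec c)
  rw [hz] at hz2
  cases hz2
  rw [EA.comm] at hb hb2
  exact EA.orth_unique _ _ _ hb hb2

theorem eq_zero_of_padd {a b : E} (h : EA.padd a b = some EA.zero) : b = EA.zero := by
  obtain ⟨x, hx, _⟩ := EA.assoc _ _ _ _ _ h (EA.zero_padd EA.one)
  exact EA.add_one _ _ hx

theorem le_refl' (a : E) : EA.le a a := ⟨_, EA.padd_zero a⟩

theorem zero_le' (a : E) : EA.le EA.zero a := ⟨_, EA.zero_padd a⟩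

theorem le_one' (a : E) : EA.le a EA.one := ⟨_, EA.compl_spec a⟩

theorem le_trans' {a b c : E} (h1 : EA.le a b) (h2 : EA.le b c) : EA.le a c := by
  obtain ⟨x, hx⟩ := h1
  obtain ⟨y, hy⟩ := h2
  obtain ⟨z, _, hz⟩ := EA.assoc _ _ _ _ _ hx hy
  exact ⟨z, hz⟩

theorem le_antisymm' {a b : E} (h1 : EA.le a b) (h2 : EA.le b a) : a = b := by
  obtain ⟨x, hx⟩ := h1
  obtain ⟨y, hy⟩ := h2
  obtain ⟨z, hz', hz⟩ := EA.assoc _ _ _ _ _ hx hy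
  have := EA.cancel hz (EA.padd_zero a)
  subst this
  rw [EA.comm] at hz'
  have := EA.eq_zero_of_padd hz'
  subst this
  rw [EA.padd_zero] at hx
  exact Option.some.inj hx

theorem le_left {a b c : E} (h : EA.padd a b = some c) : EA.le a c := ⟨_, h⟩

theorem le_right {a b c : E} (h : EA.padd a b = some c) : EA.le b c := by
  rw [EA.comm] at h; exact ⟨_, h⟩

theorem le_zero {a : E} (h : EA.le a EA.zero) : a = EA.zero :=
  EA.le_antisymm' h (EA.zero_le' a)

theorem orth_iff (a b : E) : (∃ c, EA.padd a b = some c) ↔ EA.le a (EA.compl b) := by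
  constructor
  · rintro ⟨c, hc⟩
    rw [EA.comm] at hc
    obtain ⟨x, hx, hx'⟩ := EA.assoc _ _ _ _ _ hc (EA.compl_spec c)
    rw [← EA.compl_uniq hx']
    exact ⟨_, hx⟩
  · rintro ⟨c, hc⟩
    obtain ⟨x, hx, -⟩ := EA.assoc' hc (EA.compl_spec b)
    rw [EA.comm] at hx
    exact ⟨x, hx⟩

theorem compl_le {a b : E} (h : EA.le a b) : EA.le (EA.compl b) (EA.compl a) := by
  rw [← EA.orth_iff]
  rw [← EA.compl_compl b, ← EA.orth_iff] at h
  obtain ⟨c, hc⟩ := h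
  exact ⟨c, by rw [EA.comm]; exact hc⟩

theorem le_compl_comm {a b : E} (h : EA.le a (EA.compl b)) : EA.le b (EA.compl a) := by
  have := EA.compl_le h
  rwa [EA.compl_compl] at this

theorem four {a b c d x y z : E} (h1 : EA.padd a b = some x) (h2 : EA.padd c d = some y)
    (h3 : EA.padd x y = some z) :
    ∃ ac bd, EA.padd a c = some ac ∧ EA.padd b d = some bd ∧ EA.padd ac bd = some z := by
  obtain ⟨w, hw, haw⟩ := EA.assoc _ _ _ _ _ h1 h3
  obtain ⟨v, hv, hvd⟩ := EA.assoc' h2 hw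
  rw [EA.comm] at hv
  obtain ⟨bd, hbd, hcbd⟩ := EA.assoc _ _ _ _ _ hv hvd
  obtain ⟨ac, hac, hf⟩ := EA.assoc' hcbd haw
  exact ⟨ac, bd, hac, hbd, hf⟩

theorem osub_eq {a b c : E} (h : EA.padd a c = some b) : EA.osub b a = c := by
  have hex : ∃ c, EA.padd a c = some b := ⟨c, h⟩
  unfold osub
  rw [dif_pos hex]
  exact EA.cancel hex.choose_spec h

theorem osub_spec {a b : E} (h : EA.le a b) : EA.padd a (EA.osub b a) = some b := by
  obtain ⟨c, hc⟩ := h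
  rw [EA.osub_eq hc]; exact hc

theorem oplusD_eq {a b c : E} (h : EA.padd a b = some c) : EA.oplusD a b = c := by
  unfold oplusD; rw [h]; rfl

theorem mackey_symm {a b : E} (h : EA.Mackey a b) : EA.Mackey b a := by
  obtain ⟨a1, b1, c, d, e, h1, h2, h3, h4⟩ := h
  exact ⟨b1, a1, c, d, e, by rw [EA.comm]; exact h1, h2, h4, h3⟩

theorem nsmulE_J {J : E → E} (hJ : EA.Additive J) (h0 : J EA.zero = EA.zero) (x : E) :
    ∀ (n : ℕ) (b : E), EA.nsmulE n x = some b → EA.nsmulE n (J x) = some (J b)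
  | 0, b, h => by
    simp only [nsmulE, Option.some.injEq] at h ⊢
    rw [← h, h0]
  | n + 1, b, h => by
    simp only [nsmulE, Option.bind_eq_some_iff] at h ⊢
    obtain ⟨c, hc, hb⟩ := h
    exact ⟨J c, nsmulE_J hJ h0 x n c hc, hJ _ _ _ hb⟩

end Basics

section Compr

variable {E : Type u} {EA : EffectAlgebra E} (CB : CompressionBase EA)

theorem J_add {p : E} (hp : p ∈ CB.P) {a b c : E} (h : EA.padd a b = some c) :
    EA.padd (CB.J p a) (CB.J p b) = some (CB.J p c) := (CB.compr p hp).1.1 _ _ _ h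

theorem J_zero {p : E} (hp : p ∈ CB.P) : CB.J p EA.zero = EA.zero :=
  EA.cancel (J_add CB hp (EA.padd_zero EA.zero)) (EA.padd_zero _)

theorem J_mono {p : E} (hp : p ∈ CB.P) {a b : E} (h : EA.le a b) :
    EA.le (CB.J p a) (CB.J p b) := by
  obtain ⟨c, hc⟩ := h
  exact ⟨_, J_add CB hp hc⟩

theorem J_le {p : E} (hp : p ∈ CB.P) (a : E) : EA.le (CB.J p a) p := by
  have := J_mono CB hp (EA.le_one' a)
  rwa [CB.focus p hp] at this

theorem J_of_le {p : E} (hp : p ∈ CB.P) {a : E} (h : EA.le a p) : CB.J p a = a := by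
  apply (CB.compr p hp).1.2
  rwa [CB.focus p hp]

theorem J_eq_zero {p : E} (hp : p ∈ CB.P) (a : E) :
    CB.J p a = EA.zero ↔ EA.le a (EA.compl p) := by
  have := (CB.compr p hp).2 a
  rwa [CB.focus p hp] at this

theorem compl_mem {p : E} (hp : p ∈ CB.P) : EA.compl p ∈ CB.P := CB.sub.2.2.1 p hp

theorem Jc_eq_zero {p : E} (hp : p ∈ CB.P) {a : E} (h : EA.le a p) :
    CB.J (EA.compl p) a = EA.zero := by
  rw [J_eq_zero CB (compl_mem CB hp), EA.compl_compl]; exact h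

theorem padd_mem {p q r : E} (hp : p ∈ CB.P) (hq : q ∈ CB.P) (h : EA.padd p q = some r) :
    r ∈ CB.P := CB.sub.2.2.2 p hp q hq r h

theorem osub_compl {p q c : E} (h : EA.padd p c = some q) :
    EA.padd p (EA.compl q) = some (EA.compl c) := by
  rw [EA.comm] at h
  obtain ⟨x, hx, hx'⟩ := EA.assoc _ _ _ _ _ h (EA.compl_spec q)
  rw [← EA.compl_uniq hx']
  exact hx

theorem diff_mem {p q c : E} (hp : p ∈ CB.P) (hq : q ∈ CB.P) (h : EA.padd p c = some q) :
    c ∈ CB.P := by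
  have := padd_mem CB hp (compl_mem CB hq) (osub_compl h)
  have := compl_mem CB this
  rwa [EA.compl_compl] at this

/-- the sum of two elements below a projection is below that projection -/
theorem padd_le {q x y z : E} (hq : q ∈ CB.P) (h : EA.padd x y = some z)
    (hx : EA.le x q) (hy : EA.le y q) : EA.le z q := by
  have h2 := J_add CB hq h
  rw [J_of_le CB hq hx, J_of_le CB hq hy, h] at h2
  rw [Option.some.inj h2]
  exact J_le CB hq z

theorem mackey_J {p q : E} (hq : q ∈ CB.P) {a1 b1 c d e : E}
    (h1 : EA.padd a1 b1 = some d) (h2 : EA.padd d c = some e)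
    (h3 : EA.padd a1 c = some p) (h4 : EA.padd b1 c = some q) :
    CB.J q p = c ∧ CB.J (EA.compl q) p = a1 := by
  have hq' := compl_mem CB hq
  obtain ⟨x, hx, hy⟩ := EA.assoc _ _ _ _ _ h1 h2
  rw [h4] at hx
  cases hx
  have ha : EA.le a1 (EA.compl q) := (EA.orth_iff _ _).1 ⟨_, hy⟩
  have hc : EA.le c q := EA.le_right h4
  constructor
  · have := J_add CB hq h3
    rw [(J_eq_zero CB hq a1).2 ha, J_of_le CB hq hc, EA.zero_padd] at this
    exact (Option.some.inj this).symm
  · have := J_add CB hq' h3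
    rw [Jc_eq_zero CB hq hc, J_of_le CB hq' ha, EA.padd_zero] at this
    exact (Option.some.inj this).symm

theorem inC_of_mackey {p q : E} (hq : q ∈ CB.P) (h : EA.Mackey p q) : inC EA CB p q := by
  obtain ⟨a1, b1, c, d, e, h1, h2, h3, h4⟩ := h
  obtain ⟨e1, e2⟩ := mackey_J CB hq h1 h2 h3 h4
  unfold inC
  rw [e1, e2, EA.comm]; exact h3

theorem mackey_of_inC {p q : E} (hq : q ∈ CB.P) (h : inC EA CB p q) : EA.Mackey p q := by
  have hq' := compl_mem CB hq
  have h1 := J_add CB hq (EA.compl_spec' p)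
  rw [CB.focus q hq] at h1
  have h2 : ∃ e, EA.padd (CB.J (EA.compl q) p) q = some e :=
    (EA.orth_iff _ _).2 (J_le CB hq' p)
  obtain ⟨e, he⟩ := h2
  obtain ⟨d, hd, hde⟩ := EA.assoc' h1 he
  unfold inC at h
  rw [EA.comm] at h
  exact ⟨_, _, _, d, e, hd, hde, h, h1⟩

theorem mackey_iff {p q : E} (hq : q ∈ CB.P) : EA.Mackey p q ↔ inC EA CB p q :=
  ⟨inC_of_mackey CB hq, mackey_of_inC CB hq⟩

theorem mackey_comp {p q : E} (hp : p ∈ CB.P) (hq : q ∈ CB.P) (h : EA.Mackey p q) :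
    CB.J p q ∈ CB.P ∧ CB.J p q = CB.J q p ∧ (∀ x, CB.J p (CB.J q x) = CB.J (CB.J p q) x) ∧
      ∀ x, CB.J p (CB.J q x) = CB.J q (CB.J p x) := by
  have h' := EA.mackey_symm h
  obtain ⟨r, hr, e1⟩ := CB.mackey p hp q hq h
  obtain ⟨s, hs, e2⟩ := CB.mackey q hq p hp h'
  have hr1 : CB.J p q = r := by
    have := congrFun e1 EA.one
    simpa [CB.focus q hq, CB.focus r hr] using this
  have hs1 : CB.J q p = s := by
    have := congrFun e2 EA.one
    simpa [CB.focus p hp, CB.focus s hs] using this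
  have hrs : CB.J p q = CB.J q p := by
    obtain ⟨a1, b1, c, d, e, h1, h2, h3, h4⟩ := h
    rw [(mackey_J CB hq h1 h2 h3 h4).1]
    rw [EA.comm] at h1
    rw [(mackey_J CB hp h1 h2 h4 h3).1]
  refine ⟨hr1 ▸ hr, hrs, fun x => ?_, fun x => ?_⟩
  · rw [hr1]; exact congrFun e1 x
  · have h3 := congrFun e1 x
    have h4 := congrFun e2 x
    simp only [Function.comp] at h3 h4
    rw [h3, h4, ← hr1, ← hs1, hrs]

theorem mackey_of_le {p q : E} (h : EA.le p q) : EA.Mackey p q := by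
  obtain ⟨c, hc⟩ := h
  rw [EA.comm] at hc
  exact ⟨EA.zero, c, p, c, q, EA.zero_padd c, hc, EA.zero_padd p, hc⟩

theorem mackey_of_orth {p q : E} (h : EA.le p (EA.compl q)) : EA.Mackey p q := by
  obtain ⟨c, hc⟩ := (EA.orth_iff _ _).2 h
  exact ⟨p, q, EA.zero, c, c, hc, EA.padd_zero _, EA.padd_zero _, EA.padd_zero _⟩

theorem inC_compl {x p : E} : inC EA CB x (EA.compl p) ↔ inC EA CB x p := by
  unfold inC
  rw [EA.compl_compl, EA.comm]

theorem inC_padd {p x y z : E} (hp : p ∈ CB.P) (hx : inC EA CB x p) (hy : inC EA CB y p)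
    (h : EA.padd x y = some z) : inC EA CB z p := by
  have h1 := J_add CB hp h
  have h2 := J_add CB (compl_mem CB hp) h
  unfold inC at *
  obtain ⟨ac, bd, e1, e2, e3⟩ := EA.four hx hy h
  rw [h1] at e1
  rw [h2] at e2
  cases e1
  cases e2
  exact e3

/-- for `x ≤ q`, `r ≤ q`: `J_{r'} x = J_{q ⊖ r} x` -/
theorem J_rel {q r x : E} (hq : q ∈ CB.P) (hr : r ∈ CB.P) (hrq : EA.le r q) (hx : EA.le x q) :
    CB.J (EA.osub q r) x = CB.J (EA.compl r) x := by
  have hr' := compl_mem CB hr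
  have hM : EA.Mackey q (EA.compl r) := by
    rw [mackey_iff CB hr', inC_compl, ← mackey_iff CB hr]
    exact EA.mackey_symm (mackey_of_le hrq)
  obtain ⟨-, -, h3, -⟩ := mackey_comp CB hr' hq (EA.mackey_symm hM)
  have e : CB.J (EA.compl r) q = EA.osub q r := by
    have h := inC_of_mackey CB hr (EA.mackey_symm (mackey_of_le hrq))
    unfold inC at h
    rw [show CB.J r q = r from ?_] at h
    · exact (EA.osub_eq h).symm
    · apply EA.le_antisymm' (J_le CB hr q)
      have := J_mono CB hr hrq
      rwa [J_of_le CB hr (EA.le_refl' r)] at this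
  rw [← e, ← h3, J_of_le CB hq hx]

theorem inCq_iff {q r x : E} (hq : q ∈ CB.P) (hr : r ∈ CB.P) (hrq : EA.le r q)
    (hx : EA.le x q) : inCq EA CB q x r ↔ inC EA CB x r := by
  unfold inCq inC
  rw [J_rel CB hq hr hrq hx]

theorem inC_cover {d p c : E} (hpc : ProjCoverProp EA CB) (hp : p ∈ CB.P)
    (hc : IsProjCover EA CB d c) (h : inC EA CB d p) : inC EA CB c p := by
  have hp' := compl_mem CB hp
  obtain ⟨r1, hr1⟩ := hpc (CB.J p d)
  obtain ⟨r2, hr2⟩ := hpc (CB.J (EA.compl p) d)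
  unfold inC at h
  have l1 : EA.le r1 p := (hr1.2 p hp).1 (J_le CB hp d)
  have l2 : EA.le r2 (EA.compl p) := (hr2.2 _ hp').1 (J_le CB hp' d)
  have dc : EA.le d c := (hc.2 c hc.1).2 (EA.le_refl' c)
  have m1 : EA.le r1 c := (hr1.2 c hc.1).1 (EA.le_trans' (EA.le_left h) dc)
  have m2 : EA.le r2 c := (hr2.2 c hc.1).1 (EA.le_trans' (EA.le_right h) dc)
  have n1 : EA.le (CB.J p d) r1 := (hr1.2 r1 hr1.1).2 (EA.le_refl' _)
  have n2 : EA.le (CB.J (EA.compl p) d) r2 := (hr2.2 r2 hr2.1).2 (EA.le_refl' _)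
  obtain ⟨r, hr⟩ := (EA.orth_iff r1 r2).2 (EA.le_trans' l1 (by
    have := EA.compl_le l2
    rwa [EA.compl_compl] at this))
  have hrP := padd_mem CB hr1.1 hr2.1 hr
  have dr : EA.le d r := padd_le CB hrP h (EA.le_trans' n1 (EA.le_left hr))
    (EA.le_trans' n2 (EA.le_right hr))
  have e : c = r := EA.le_antisymm' ((hc.2 r hrP).1 dr) (padd_le CB hc.1 hr m1 m2)
  have i1 : inC EA CB r1 p := inC_of_mackey CB hp (mackey_of_le l1)
  have i2 : inC EA CB r2 p := inC_of_mackey CB hp (mackey_of_orth l2)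
  rw [e]
  exact inC_padd CB hp i1 i2 hr

theorem projCover_spec {a : E} (hpc : ProjCoverProp EA CB) :
    IsProjCover EA CB a (projCover EA CB a) := by
  unfold projCover
  rw [dif_pos (hpc a)]
  exact (hpc a).choose_spec

theorem projCoverq_eq {q a : E} (hpc : ProjCoverProp EA CB) (hq : q ∈ CB.P) (h : EA.le a q) :
    projCoverq EA CB q a = projCover EA CB a := by
  have hc := projCover_spec CB (a := a) hpc
  have hex : ∃ p, IsProjCoverq EA CB q a p :=
    ⟨projCover EA CB a, ⟨hc.1, (hc.2 q hq).1 h⟩, fun s hs => hc.2 s hs.1⟩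
  unfold projCoverq
  rw [dif_pos hex]
  have h2 := hex.choose_spec
  set p := hex.choose
  have hap : EA.le a p := (h2.2 p h2.1).2 (EA.le_refl' _)
  apply EA.le_antisymm'
  · exact (h2.2 _ ⟨hc.1, (hc.2 q hq).1 h⟩).1 ((hc.2 _ hc.1).2 (EA.le_refl' _))
  · exact (hc.2 p h2.1.1).1 hap

theorem pmeet_eq {p q m : E} (h : IsMeetP EA CB p q m) : pmeet EA CB p q = m := by
  have hex : ∃ m, IsMeetP EA CB p q m := ⟨m, h⟩
  unfold pmeet
  rw [dif_pos hex]
  have h2 := hex.choose_spec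
  exact EA.le_antisymm' (h.2.2.2 _ h2.1 h2.2.1 h2.2.2.1) (h2.2.2.2 _ h.1 h.2.1 h.2.2.1)

end Compr

end EffectAlgebra

namespace EffectAlgebra

section LGroup

variable {G : Type*} [AddCommGroup G] [Lattice G] [IsOrderedAddMonoid G]

theorem two_nsmul_sup (g : G) : (2 : ℕ) • (g ⊔ 0) = ((2 : ℕ) • g) ⊔ 0 := by
  apply le_antisymm
  · have h : g ≤ ((2 : ℕ) • g) ⊔ 0 := by
      have h1 : 0 ≤ (((2 : ℕ) • g) ⊔ 0) - g := by
        rw [sup_sub]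
        have e1 : (2 : ℕ) • g - g = g := by rw [two_nsmul]; abel
        rw [e1, zero_sub]
        exact abs_nonneg g
      exact sub_nonneg.1 h1
    rw [two_nsmul, sup_add, add_sup, add_sup]
    simp only [add_zero, zero_add]
    refine sup_le (sup_le ?_ h) (sup_le h le_sup_right)
    rw [← two_nsmul]; exact le_sup_left
  · refine sup_le (nsmul_le_nsmul_right le_sup_left 2) (nsmul_nonneg le_sup_right 2)

theorem pow_nsmul_sup (g : G) (k : ℕ) : (2 ^ k : ℕ) • (g ⊔ 0) = ((2 ^ k : ℕ) • g) ⊔ 0 := by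
  induction k with
  | zero => simp
  | succ k ih => rw [pow_succ, mul_nsmul, ih, two_nsmul_sup, ← mul_nsmul]

theorem nonneg_of_pow {g : G} (k : ℕ) (h : 0 ≤ (2 ^ k : ℕ) • g) : 0 ≤ g := by
  have h1 := pow_nsmul_sup (-g) k
  have h2 : ((2 ^ k : ℕ) • (-g)) ⊔ 0 = 0 := by
    rw [sup_eq_right, smul_neg]; exact neg_nonpos.2 h
  rw [h2] at h1
  have h3 : (-g) ⊔ 0 ≤ (2 ^ k : ℕ) • ((-g) ⊔ 0) :=
    le_self_nsmul le_sup_right (pow_ne_zero _ two_ne_zero)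
  rw [h1] at h3
  exact neg_nonpos.1 (le_trans le_sup_left h3)

theorem inf_nsmul_le {g v : G} (hg : 0 ≤ g) (hv : 0 ≤ v) (n : ℕ) :
    g ⊓ (n • v) ≤ n • (g ⊓ v) := by
  induction n with
  | zero => simp
  | succ n ih =>
    have h0 : 0 ≤ g ⊓ v := le_inf hg hv
    have h1 : g ⊓ ((n + 1) • v) - (g ⊓ v) ≤ g ⊓ (n • v) := by
      refine le_inf ?_ ?_
      · exact le_trans (sub_le_self _ h0) inf_le_left
      · rw [sub_inf]
        refine sup_le ?_ ?_
        · exact le_trans (sub_nonpos.2 inf_le_left) (nsmul_nonneg hv n)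
        · rw [sub_le_iff_le_add, ← succ_nsmul]; exact inf_le_right
    rw [succ_nsmul (g ⊓ v)]
    exact sub_le_iff_le_add.1 (le_trans h1 ih)

end LGroup

structure Rep {E : Type u} (EA : EffectAlgebra E) (CB : CompressionBase EA) (B : Set E)
    {G : Type u} [AddCommGroup G] [Lattice G] [IsOrderedAddMonoid G]
    (v : G) (φ : E → G) (Ut : E → G → G) : Prop where
  hpc : ProjCoverProp EA CB
  hbc : BComparability EA CB
  hB : IsBlock EA CB B
  one : φ EA.one = v
  hmem : ∀ x ∈ Cblock EA CB B, 0 ≤ φ x ∧ φ x ≤ v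
  hinj : ∀ x ∈ Cblock EA CB B, ∀ y ∈ Cblock EA CB B, φ x = φ y → x = y
  hsurj : ∀ g : G, 0 ≤ g → g ≤ v → ∃ x ∈ Cblock EA CB B, φ x = g
  hadd : ∀ x ∈ Cblock EA CB B, ∀ y ∈ Cblock EA CB B, ∀ z : E,
      EA.padd x y = some z → φ z = φ x + φ y
  hadd' : ∀ x ∈ Cblock EA CB B, ∀ y ∈ Cblock EA CB B, φ x + φ y ≤ v →
      ∃ z : E, EA.padd x y = some z
  ext : ∀ f g : G → G, (∀ x y, f (x + y) = f x + f y) → (∀ x y, g (x + y) = g x + g y) →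
      (∀ x ∈ Cblock EA CB B, f (φ x) = g (φ x)) → ∀ x, f x = g x
  Uadd : ∀ p ∈ B, ∀ g g' : G, Ut p (g + g') = Ut p g + Ut p g'
  Umono : ∀ p ∈ B, ∀ g g' : G, g ≤ g' → Ut p g ≤ Ut p g'
  UJ : ∀ p ∈ B, ∀ x ∈ Cblock EA CB B, Ut p (φ x) = φ (CB.J p x)

theorem inC_sub {E : Type u} {EA : EffectAlgebra E} (CB : CompressionBase EA)
    {p x y z : E} (hp : p ∈ CB.P) (hx : inC EA CB x p) (hz : inC EA CB z p)
    (h : EA.padd x y = some z) : inC EA CB y p := by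
  have h1 := J_add CB hp h
  have h2 := J_add CB (compl_mem CB hp) h
  unfold inC at *
  obtain ⟨ac, bd, e1, e2, e3⟩ := EA.four h1 h2 hz
  rw [hx] at e1
  cases e1
  rw [e2, EA.cancel e3 h]

namespace Rep

variable {E : Type u} {EA : EffectAlgebra E} {CB : CompressionBase EA} {B : Set E}
    {G : Type u} [AddCommGroup G] [Lattice G] [IsOrderedAddMonoid G]
    {v : G} {φ : E → G} {Ut : E → G → G}

theorem BP (R : Rep EA CB B v φ Ut) {p : E} (hp : p ∈ B) : p ∈ CB.P := R.hB.1 hp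

theorem mem_of (R : Rep EA CB B v φ Ut) {p : E} (hp : p ∈ CB.P) (h : ∀ b ∈ B, EA.Mackey p b) : p ∈ B := by
  have h2 := R.hB.2.2 (insert p B) (by
    intro x hx
    rcases hx with rfl | hx
    · exact hp
    · exact R.hB.1 hx) (by
    intro x hx y hy
    rcases hx with rfl | hx
    · rcases hy with rfl | hy
      · exact mackey_of_le (EA.le_refl' _)
      · exact h y hy
    · rcases hy with rfl | hy
      · exact EA.mackey_symm (h x hx)
      · exact R.hB.2.1 x hx y hy) (Set.subset_insert _ _)
  rw [← h2]
  exact Set.mem_insert _ _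

theorem mem_B_of_C (R : Rep EA CB B v φ Ut) {p : E} (hp : p ∈ CB.P) (h : p ∈ Cblock EA CB B) : p ∈ B :=
  R.mem_of hp fun b hb => mackey_of_inC CB (R.BP hb) (h b hb)

theorem BC (R : Rep EA CB B v φ Ut) {p : E} (hp : p ∈ B) : p ∈ Cblock EA CB B := fun b hb =>
  inC_of_mackey CB (R.BP hb) (R.hB.2.1 p hp b hb)

theorem C_add (R : Rep EA CB B v φ Ut) {x y z : E} (hx : x ∈ Cblock EA CB B) (hy : y ∈ Cblock EA CB B)
    (h : EA.padd x y = some z) : z ∈ Cblock EA CB B := fun b hb =>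
  inC_padd CB (R.BP hb) (hx b hb) (hy b hb) h

theorem C_sub (R : Rep EA CB B v φ Ut) {x y z : E} (hx : x ∈ Cblock EA CB B) (hz : z ∈ Cblock EA CB B)
    (h : EA.padd x y = some z) : y ∈ Cblock EA CB B := fun b hb =>
  inC_sub CB (R.BP hb) (hx b hb) (hz b hb) h

theorem C_one (R : Rep EA CB B v φ Ut) : EA.one ∈ Cblock EA CB B := fun b hb =>
  inC_of_mackey CB (R.BP hb) (EA.mackey_symm (mackey_of_le (EA.le_one' b)))

theorem C_zero (R : Rep EA CB B v φ Ut) : EA.zero ∈ Cblock EA CB B := fun b hb =>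
  inC_of_mackey CB (R.BP hb) (mackey_of_le (EA.zero_le' b))

theorem B_one (R : Rep EA CB B v φ Ut) : EA.one ∈ B := R.mem_B_of_C CB.sub.2.1 R.C_one

theorem B_compl (R : Rep EA CB B v φ Ut) {p : E} (hp : p ∈ B) : EA.compl p ∈ B :=
  R.mem_B_of_C (compl_mem CB (R.BP hp)) (R.C_sub (R.BC hp) R.C_one (EA.compl_spec p))

theorem B_add (R : Rep EA CB B v φ Ut) {x y z : E} (hx : x ∈ B) (hy : y ∈ B)
    (h : EA.padd x y = some z) : z ∈ B :=
  R.mem_B_of_C (padd_mem CB (R.BP hx) (R.BP hy) h) (R.C_add (R.BC hx) (R.BC hy) h)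

theorem B_sub (R : Rep EA CB B v φ Ut) {x y z : E} (hx : x ∈ B) (hz : z ∈ B)
    (h : EA.padd x y = some z) : y ∈ B :=
  R.mem_B_of_C (diff_mem CB (R.BP hx) (R.BP hz) h) (R.C_sub (R.BC hx) (R.BC hz) h)

theorem comp (R : Rep EA CB B v φ Ut) {p q : E} (hp : p ∈ B) (hq : q ∈ B) :
    CB.J p q ∈ CB.P ∧ CB.J p q = CB.J q p ∧ (∀ x, CB.J p (CB.J q x) = CB.J (CB.J p q) x) ∧
      ∀ x, CB.J p (CB.J q x) = CB.J q (CB.J p x) :=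
  mackey_comp CB (R.BP hp) (R.BP hq) (R.hB.2.1 p hp q hq)

theorem C_J (R : Rep EA CB B v φ Ut) {p x : E} (hp : p ∈ B) (hx : x ∈ Cblock EA CB B) :
    CB.J p x ∈ Cblock EA CB B := by
  intro b hb
  have h := hx b hb
  unfold inC at *
  rw [(R.comp hb hp).2.2.2 x, (R.comp (R.B_compl hb) hp).2.2.2 x]
  exact J_add CB (R.BP hp) h

theorem B_J (R : Rep EA CB B v φ Ut) {p q : E} (hp : p ∈ B) (hq : q ∈ B) : CB.J p q ∈ B :=
  R.mem_B_of_C (R.comp hp hq).1 (R.C_J hp (R.BC hq))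

theorem phi_zero (R : Rep EA CB B v φ Ut) : φ EA.zero = 0 := by
  have := R.hadd _ R.C_zero _ R.C_zero _ (EA.padd_zero _)
  simpa using this

theorem phi_mono (R : Rep EA CB B v φ Ut) {x y : E} (hx : x ∈ Cblock EA CB B) (hy : y ∈ Cblock EA CB B)
    (h : EA.le x y) : φ x ≤ φ y := by
  obtain ⟨c, hc⟩ := h
  have hcC := R.C_sub hx hy hc
  rw [R.hadd _ hx _ hcC _ hc]
  exact le_add_of_nonneg_right (R.hmem c hcC).1

theorem le_of_phi (R : Rep EA CB B v φ Ut) {x y : E} (hx : x ∈ Cblock EA CB B) (hy : y ∈ Cblock EA CB B)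
    (h : φ x ≤ φ y) : EA.le x y := by
  obtain ⟨c, hc, e⟩ := R.hsurj (φ y - φ x) (sub_nonneg.2 h)
    (le_trans (sub_le_self _ (R.hmem x hx).1) (R.hmem y hy).2)
  have e2 : φ x + φ c = φ y := by rw [e]; abel
  obtain ⟨z, hz⟩ := R.hadd' x hx c hc (by rw [e2]; exact (R.hmem y hy).2)
  have e3 := R.hadd x hx c hc z hz
  have := R.hinj z (R.C_add hx hc hz) y hy (by rw [e3, e2])
  exact ⟨c, by rw [hz, this]⟩

theorem eq_zero_of_phi (R : Rep EA CB B v φ Ut) {x : E} (hx : x ∈ Cblock EA CB B) (h : φ x = 0) : x = EA.zero :=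
  R.hinj x hx _ R.C_zero (by rw [h, R.phi_zero])

theorem U_one (R : Rep EA CB B v φ Ut) {p : E} (hp : p ∈ B) : Ut p v = φ p := by
  rw [← R.one, R.UJ p hp _ R.C_one, CB.focus p (R.BP hp)]

theorem hom (R : Rep EA CB B v φ Ut) {p : E} (hp : p ∈ B) : ∃ f : G →+ G, ∀ g, Ut p g = f g :=
  ⟨AddMonoidHom.mk' (Ut p) (R.Uadd p hp), fun _ => rfl⟩

theorem U_zero (R : Rep EA CB B v φ Ut) {p : E} (hp : p ∈ B) : Ut p 0 = 0 := by
  obtain ⟨f, hf⟩ := R.hom hp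
  simp [hf]

theorem U_sub (R : Rep EA CB B v φ Ut) {p : E} (hp : p ∈ B) (x y : G) : Ut p (x - y) = Ut p x - Ut p y := by
  obtain ⟨f, hf⟩ := R.hom hp
  simp [hf]

theorem U_nsmul (R : Rep EA CB B v φ Ut) {p : E} (hp : p ∈ B) (n : ℕ) (x : G) : Ut p (n • x) = n • Ut p x := by
  obtain ⟨f, hf⟩ := R.hom hp
  simp [hf]

theorem U_nonneg (R : Rep EA CB B v φ Ut) {p : E} (hp : p ∈ B) {x : G} (h : 0 ≤ x) : 0 ≤ Ut p x := by
  have := R.Umono p hp _ _ h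
  rwa [R.U_zero hp] at this

theorem U_nonpos (R : Rep EA CB B v φ Ut) {p : E} (hp : p ∈ B) {x : G} (h : x ≤ 0) : Ut p x ≤ 0 := by
  have := R.Umono p hp _ _ h
  rwa [R.U_zero hp] at this

theorem U_comm (R : Rep EA CB B v φ Ut) {p q : E} (hp : p ∈ B) (hq : q ∈ B) (g : G) :
    Ut p (Ut q g) = Ut q (Ut p g) := by
  refine R.ext (fun g => Ut p (Ut q g)) (fun g => Ut q (Ut p g)) ?_ ?_ ?_ g
  · intro x y
    simp only [R.Uadd q hq, R.Uadd p hp]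
  · intro x y
    simp only [R.Uadd q hq, R.Uadd p hp]
  · intro x hx
    rw [R.UJ q hq x hx, R.UJ p hp x hx, R.UJ _ hp _ (R.C_J hq hx), R.UJ _ hq _ (R.C_J hp hx),
      (R.comp hp hq).2.2.2]

theorem U_of_le (R : Rep EA CB B v φ Ut) {p q : E} (hp : p ∈ B) (hq : q ∈ B) (h : EA.le p q) (g : G) :
    Ut p (Ut q g) = Ut p g := by
  refine R.ext (fun g => Ut p (Ut q g)) (fun g => Ut p g) ?_ ?_ ?_ g
  · intro x y
    simp only [R.Uadd q hq, R.Uadd p hp]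
  · intro x y
    simp only [R.Uadd p hp]
  · intro x hx
    rw [R.UJ q hq x hx, R.UJ _ hp _ (R.C_J hq hx), R.UJ p hp x hx, (R.comp hp hq).2.2.1,
      (R.comp hp hq).2.1, J_of_le CB (R.BP hq) h]

/-- additivity of `U` in the projection -/
theorem U_padd (R : Rep EA CB B v φ Ut) {p q r : E} (hp : p ∈ B) (hq : q ∈ B) (h : EA.padd p q = some r) (g : G) :
    Ut r g = Ut p g + Ut q g := by
  have hr := R.B_add hp hq h
  refine R.ext (fun g => Ut r g) (fun g => Ut p g + Ut q g) ?_ ?_ ?_ g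
  · intro x y
    simp only [R.Uadd r hr]
  · intro x y
    simp only [R.Uadd p hp, R.Uadd q hq]
    abel
  · intro x hx
    have hp' := R.B_compl hp
    have h1 := hx p hp
    unfold inC at h1
    have h2 := J_add CB (R.BP hr) h1
    have e1 : CB.J r (CB.J p x) = CB.J p x :=
      J_of_le CB (R.BP hr) (EA.le_trans' (J_le CB (R.BP hp) x) (EA.le_left h))
    have e0 : CB.J (EA.compl p) r = q := by
      have h3 := J_add CB (R.BP hp') h
      rw [Jc_eq_zero CB (R.BP hp) (EA.le_refl' p), EA.zero_padd] at h3
      rw [← Option.some.inj h3]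
      apply J_of_le CB (R.BP hp')
      rw [← EA.orth_iff]
      exact ⟨r, by rw [EA.comm]; exact h⟩
    have e2 : CB.J r (CB.J (EA.compl p) x) = CB.J q x := by
      rw [(R.comp hr hp').2.2.1, (R.comp hr hp').2.1, e0]
    rw [e1, e2] at h2
    rw [R.UJ r hr x hx, R.UJ p hp x hx, R.UJ q hq x hx]
    exact R.hadd _ (R.C_J hp hx) _ (R.C_J hq hx) _ h2

theorem U_id (R : Rep EA CB B v φ Ut) (g : G) : Ut EA.one g = g := by
  refine R.ext (fun g => Ut EA.one g) (fun g => g) (R.Uadd _ R.B_one) (fun _ _ => rfl) ?_ g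
  intro x hx
  rw [R.UJ _ R.B_one x hx, J_of_le CB (R.BP R.B_one) (EA.le_one' x)]

theorem U_compl (R : Rep EA CB B v φ Ut) {p : E} (hp : p ∈ B) (g : G) : g = Ut p g + Ut (EA.compl p) g := by
  rw [← R.U_padd hp (R.B_compl hp) (EA.compl_spec p), R.U_id]

theorem U_sup (R : Rep EA CB B v φ Ut) {p : E} (hp : p ∈ B) (g : G) : Ut p (g ⊔ 0) ≤ Ut p g ⊔ 0 := by
  have hp' := R.B_compl hp
  have h : g ⊔ 0 ≤ (Ut p g ⊔ 0) + Ut (EA.compl p) (g ⊔ 0) := by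
    refine sup_le ?_ (add_nonneg le_sup_right (R.U_nonneg hp' le_sup_right))
    conv_lhs => rw [R.U_compl hp g]
    exact add_le_add le_sup_left (R.Umono _ hp' _ _ le_sup_left)
  have h2 := R.U_compl hp (g ⊔ 0)
  rw [h2] at h
  have h3 := R.U_compl hp (g ⊔ 0)
  rw [← h3] at h
  conv_lhs at h => rw [h3]
  exact le_of_add_le_add_right h

theorem cover_mem (R : Rep EA CB B v φ Ut) {d : E} (hd : d ∈ Cblock EA CB B) : projCover EA CB d ∈ B := by
  have h := projCover_spec CB (a := d) R.hpc
  exact R.mem_B_of_C h.1 fun b hb => inC_cover CB R.hpc (R.BP hb) h (hd b hb)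

theorem le_cover (R : Rep EA CB B v φ Ut) (d : E) : EA.le d (projCover EA CB d) := by
  have h := projCover_spec CB (a := d) R.hpc
  exact (h.2 _ h.1).2 (EA.le_refl' _)

theorem cover_le (R : Rep EA CB B v φ Ut) {d q : E} (hq : q ∈ CB.P) (h : EA.le d q) : EA.le (projCover EA CB d) q :=
  ((projCover_spec CB (a := d) R.hpc).2 q hq).1 h

/-! relative comparability -/

theorem inCq_meet {p q x : E} (hp : p ∈ CB.P) (hq : q ∈ CB.P) (hM : EA.Mackey p q)
    (hx : EA.le x q) : inCq EA CB q x (CB.J p q) ↔ inC EA CB x p := by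
  have hp' := compl_mem CB hp
  have hM' : EA.Mackey (EA.compl p) q := by
    apply EA.mackey_symm
    rw [mackey_iff CB hp', inC_compl, ← mackey_iff CB hp]
    exact EA.mackey_symm hM
  have h := inC_of_mackey CB hp (EA.mackey_symm hM)
  unfold inC at h
  unfold inCq inC
  rw [EA.osub_eq h, ← (mackey_comp CB hp hq hM).2.2.1, ← (mackey_comp CB hp' hq hM').2.2.1,
    J_of_le CB hq hx]

theorem Pleq_mem (R : Rep EA CB B v φ Ut) {q e f s : E} (hq : q ∈ B) (he : e ∈ Cblock EA CB B)
    (hf : f ∈ Cblock EA CB B) (heq : EA.le e q) (hfq : EA.le f q)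
    (hs : s ∈ Pleq EA CB q e f) : s ∈ B := by
  obtain ⟨⟨⟨hsP, hsq⟩, h1⟩, -, -⟩ := hs
  refine R.mem_of hsP fun b hb => EA.mackey_symm (mackey_of_inC CB hsP ?_)
  have hbq : CB.J b q ∈ B := R.B_J hb hq
  have hle : EA.le (CB.J b q) q := by
    rw [(R.comp hb hq).2.1]; exact J_le CB (R.BP hq) b
  have hM := R.hB.2.1 b hb q hq
  have h2 : CB.J b q ∈ PCsetq EA CB q {e, f} := by
    refine ⟨⟨R.BP hbq, hle⟩, ?_⟩
    intro x hx
    rcases hx with rfl | hx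
    · exact (inCq_meet (R.BP hb) (R.BP hq) hM heq).2 (he b hb)
    · rw [Set.mem_singleton_iff] at hx
      subst hx
      exact (inCq_meet (R.BP hb) (R.BP hq) hM hfq).2 (hf b hb)
  have h3 := h1 _ (Or.inl h2)
  rw [inCq_iff CB (R.BP hq) hsP hsq hle] at h3
  have h4 := R.BC hb q hq
  unfold inC at h4
  rw [← (R.comp hb hq).2.1] at h4
  refine inC_padd CB hsP h3 ?_ h4
  apply inC_of_mackey CB hsP
  apply mackey_of_orth
  exact EA.le_trans' (J_le CB (R.BP (R.B_compl hq)) b) (EA.compl_le hsq)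

theorem Pleq_nonempty (R : Rep EA CB B v φ Ut) {q e f : E} (hq : q ∈ B) (he : e ∈ Cblock EA CB B)
    (hf : f ∈ Cblock EA CB B) (heq : EA.le e q) (hfq : EA.le f q) :
    (Pleq EA CB q e f).Nonempty := by
  have key : ∀ x ∈ Cblock EA CB B, ∀ p ∈ bicomm EA CB x, p ∈ B := by
    intro x hx p hp
    exact R.mem_B_of_C hp.1.1 fun b hb => hp.2 b ⟨R.BP hb, hx b hb⟩
  obtain ⟨p, hp, h1, h2⟩ := R.hbc.2 e f (fun p hp r hr =>
    R.hB.2.1 p (key e he p hp) r (key f hf r hr))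
  have hqP := R.BP hq
  have hpB : p ∈ B := R.mem_of hp.1 fun b hb => by
    refine EA.mackey_symm (mackey_of_inC CB hp.1 (hp.2 b (Or.inl ⟨R.BP hb, ?_⟩)))
    intro x hx
    rcases hx with rfl | hx
    · exact he b hb
    · rw [Set.mem_singleton_iff] at hx
      subst hx
      exact hf b hb
  have hM := R.hB.2.1 p hpB q hq
  have hle : EA.le (CB.J p q) q := by
    rw [(R.comp hpB hq).2.1]; exact J_le CB hqP p
  have hos : EA.osub q (CB.J p q) = CB.J (EA.compl p) q :=
    EA.osub_eq (inC_of_mackey CB hp.1 (EA.mackey_symm hM))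
  have J1 : ∀ x, EA.le x q → CB.J (CB.J p q) x = CB.J p x := fun x hx => by
    rw [← (R.comp hpB hq).2.2.1, J_of_le CB hqP hx]
  have J2 : ∀ x, EA.le x q → CB.J (EA.osub q (CB.J p q)) x = CB.J (EA.compl p) x :=
    fun x hx => by
    rw [hos, ← (R.comp (R.B_compl hpB) hq).2.2.1, J_of_le CB hqP hx]
  refine ⟨CB.J p q, ⟨⟨(R.comp hpB hq).1, hle⟩, ?_⟩, ?_, ?_⟩
  · intro x hx
    rcases hx with hx | hx
    · obtain ⟨⟨hxP, hxq⟩, h3⟩ := hx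
      rw [inCq_meet hp.1 hqP hM hxq]
      refine hp.2 x (Or.inl ⟨hxP, ?_⟩)
      intro y hy
      have := h3 y hy
      rcases hy with rfl | hy
      · exact (inCq_iff CB hqP hxP hxq heq).1 this
      · rw [Set.mem_singleton_iff] at hy
        subst hy
        exact (inCq_iff CB hqP hxP hxq hfq).1 this
    · have hxq : EA.le x q := by
        rcases hx with rfl | hy
        · exact heq
        · rw [Set.mem_singleton_iff] at hy
          subst hy
          exact hfq
      rw [inCq_meet hp.1 hqP hM hxq]
      exact hp.2 x (Or.inr hx)
  · rw [J1 e heq, J1 f hfq]; exact h1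
  · rw [J2 e heq, J2 f hfq]; exact h2

end Rep

end EffectAlgebra

namespace EffectAlgebra

/-- integer value of a binary string given in reversed order -/
def nR : List Bool → ℕ
  | [] => 0
  | b :: t => 2 * nR t + (if b then 1 else 0)

theorem lamOf_append (w : List Bool) (b : Bool) :
    lamOf (w ++ [b]) = lamOf w + (if b then 1 else 0) / 2 ^ (w.length + 1) := by
  induction w with
  | nil => simp [lamOf]
  | cons x t ih =>
    simp only [List.cons_append, lamOf, ih, List.length_cons]
    rw [pow_succ (2 : ℚ) (t.length + 1)]
    field_simp
    ring

theorem lamOf_reverse (t : List Bool) : lamOf t.reverse = (nR t : ℚ) / 2 ^ t.length := by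
  induction t with
  | nil => simp [lamOf, nR]
  | cons b t ih =>
    rw [List.reverse_cons, lamOf_append, ih, nR]
    simp only [List.length_reverse, List.length_cons]
    rw [pow_succ]
    cases b <;> simp <;> field_simp

theorem lamOf_eq (w : List Bool) : lamOf w = (nR w.reverse : ℚ) / 2 ^ w.length := by
  have := lamOf_reverse w.reverse
  simpa using this

theorem length_allStrings (n : ℕ) : ∀ w ∈ allStrings n, w.length = n := by
  induction n with
  | zero => simp [allStrings]
  | succ n ih =>
    intro w hw
    simp only [allStrings, List.mem_flatMap] at hw
    obtain ⟨x, hx, hw⟩ := hw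
    simp at hw
    rcases hw with rfl | rfl <;> simp [ih x hx]

theorem exists_word (n : ℕ) : ∀ k : ℕ, 0 < (k : ℚ) / 2 ^ n → (k : ℚ) / 2 ^ n < 1 →
    ∃ w : List Bool, lamOf (w ++ [true]) = (k : ℚ) / 2 ^ n := by
  induction n with
  | zero =>
    intro k h0 h1
    simp only [pow_zero, div_one] at h0 h1
    norm_cast at h0 h1
    omega
  | succ n ih =>
    intro k h0 h1
    have h2 : (0 : ℚ) < 2 ^ n := by positivity
    have e : (k : ℚ) / 2 ^ (n + 1) = ((k : ℚ) / 2 ^ n) / 2 := by rw [pow_succ]; field_simp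
    rw [e] at h0 h1 ⊢
    rcases lt_trichotomy ((k : ℚ) / 2 ^ n) 1 with h | h | h
    · obtain ⟨w, hw⟩ := ih k (by linarith) h
      refine ⟨false :: w, ?_⟩
      simp [lamOf, hw]
    · refine ⟨[], ?_⟩
      rw [h]; simp [lamOf]
    · have hk : 2 ^ n ≤ k := by
        rw [lt_div_iff₀ h2, one_mul] at h
        exact_mod_cast h.le
      have e2 : ((k - 2 ^ n : ℕ) : ℚ) / 2 ^ n = (k : ℚ) / 2 ^ n - 1 := by
        rw [Nat.cast_sub hk]; push_cast; field_simp
      obtain ⟨w, hw⟩ := ih (k - 2 ^ n) (by rw [e2]; linarith) (by rw [e2]; linarith)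
      refine ⟨true :: w, ?_⟩
      simp only [List.cons_append, lamOf, hw, e2, if_true]
      ring

namespace Rep

variable {E : Type u} {EA : EffectAlgebra E} {CB : CompressionBase EA} {B : Set E}
    {G : Type u} [AddCommGroup G] [Lattice G] [IsOrderedAddMonoid G]
    {v : G} {φ : E → G} {Ut : E → G → G}

theorem step (R : Rep EA CB B v φ Ut) {q c : E} (hq : q ∈ B) (hc : c ∈ Cblock EA CB B) (hcq : EA.le c q) :
    ∃ d s u0 e : E, posPartq EA CB q (EA.osub q c) c = d ∧ projCoverq EA CB q d = s ∧
      pmeet EA CB (EA.osub q s) q = u0 ∧ pmeet EA CB q (EA.compl u0) = s ∧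
      EA.oplusD (CB.J u0 c) (CB.J u0 c) = e ∧ s ∈ B ∧ u0 ∈ B ∧ EA.padd u0 s = some q ∧
      d ∈ Cblock EA CB B ∧ EA.le d s ∧ (2 : ℕ) • Ut s (φ c) = φ s + φ d ∧
      e ∈ Cblock EA CB B ∧ EA.le e u0 ∧ (2 : ℕ) • Ut u0 (φ c) = φ e := by
  have hqP := R.BP hq
  have hqC := R.BC hq
  have hosub := EA.osub_spec hcq
  have hc'C : EA.osub q c ∈ Cblock EA CB B := R.C_sub hc hqC hosub
  have hc'q : EA.le (EA.osub q c) q := EA.le_right hosub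
  have hφ' : φ (EA.osub q c) = φ q - φ c := by
    rw [R.hadd _ hc _ hc'C _ hosub]; abel
  have hne := R.Pleq_nonempty hq hc'C hc hc'q hcq
  have hp := hne.some_mem
  have hdef : posPartq EA CB q (EA.osub q c) c =
      EA.osub (CB.J hne.some c) (CB.J hne.some (EA.osub q c)) := by
    unfold posPartq
    rw [dif_pos hne]
  rw [hdef]
  generalize hne.some = p at hp
  have hpB := R.Pleq_mem hq hc'C hc hc'q hcq hp
  have hpP := R.BP hpB
  obtain ⟨⟨⟨-, hpq⟩, -⟩, hle1, hle2⟩ := hp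
  rw [J_rel CB hqP hpP hpq hcq, J_rel CB hqP hpP hpq hc'q] at hle2
  have hp'B := R.B_compl hpB
  have hds := EA.osub_spec hle1
  generalize EA.osub (CB.J p c) (CB.J p (EA.osub q c)) = d at hds
  have hdC : d ∈ Cblock EA CB B := R.C_sub (R.C_J hpB hc'C) (R.C_J hpB hc) hds
  have hdφ : φ d = Ut p ((2 : ℕ) • φ c - φ q) := by
    have h := R.hadd _ (R.C_J hpB hc'C) _ hdC _ hds
    rw [← R.UJ p hpB _ hc, ← R.UJ p hpB _ hc'C, hφ'] at h
    have : φ d = Ut p (φ c) - Ut p (φ q - φ c) := by rw [h]; abel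
    rw [this, ← R.U_sub hpB]
    congr 1
    rw [two_nsmul]; abel
  have hdp : EA.le d p := EA.le_trans' (EA.le_right hds) (J_le CB hpP c)
  have hdq : EA.le d q := EA.le_trans' hdp hpq
  have hsB := R.cover_mem hdC
  have hsq := R.cover_le hqP hdq
  have hsp := R.cover_le hpP hdp
  have hdle := R.le_cover d
  have hcov := projCoverq_eq CB R.hpc hqP hdq
  generalize projCover EA CB d = s at hsB hsq hsp hdle hcov
  have hu0 := EA.osub_spec hsq
  have hu0B : EA.osub q s ∈ B := R.B_sub hsB hq hu0
  have hmeet : pmeet EA CB (EA.osub q s) q = EA.osub q s :=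
    pmeet_eq CB ⟨R.BP hu0B, EA.le_refl' _, EA.le_right hu0, fun _ _ h _ => h⟩
  generalize hgu : EA.osub q s = u0 at hu0 hu0B hmeet
  have hu0' : EA.padd u0 s = some q := by rw [EA.comm]; exact hu0
  have hmeet2 : pmeet EA CB q (EA.compl u0) = s := by
    apply pmeet_eq CB
    refine ⟨R.BP hsB, hsq, (EA.orth_iff _ _).1 ⟨_, hu0⟩, ?_⟩
    intro t htP htq htu
    obtain ⟨z, hz⟩ := (EA.orth_iff _ _).2 htu
    rw [EA.comm] at hz
    have hzq := padd_le CB hqP hz (EA.le_right hu0) htq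
    obtain ⟨y, hy⟩ := hzq
    obtain ⟨x, hx, hx'⟩ := EA.assoc _ _ _ _ _ hz hy
    rw [EA.cancel hx' hu0'] at hx
    exact ⟨_, hx⟩
  have hUds : Ut s (φ d) = φ d := by
    rw [R.UJ s hsB d hdC, J_of_le CB (R.BP hsB) hdle]
  have hUu0d : Ut u0 (φ d) = 0 := by
    rw [R.UJ u0 hu0B d hdC, (J_eq_zero CB (R.BP hu0B) d).2, R.phi_zero]
    exact EA.le_trans' hdle ((EA.orth_iff _ _).1 ⟨_, hu0⟩)
  have hUq : ∀ x ∈ B, EA.le x q → Ut x (φ q) = φ x := by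
    intro x hx hxq
    rw [← R.U_one hq, R.U_of_le hx hq hxq, R.U_one hx]
  have h2s : (2 : ℕ) • Ut s (φ c) = φ s + φ d := by
    rw [← hUds, hdφ, R.U_of_le hsB hpB hsp, R.U_sub hsB, R.U_nsmul hsB, hUq s hsB hsq]
    abel
  have hu0q := EA.le_right hu0
  have hneg : Ut (EA.compl p) ((2 : ℕ) • φ c - φ q) ≤ 0 := by
    have h := R.phi_mono (R.C_J hp'B hc) (R.C_J hp'B hc'C) hle2
    rw [← R.UJ _ hp'B _ hc, ← R.UJ _ hp'B _ hc'C, hφ', R.U_sub hp'B] at h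
    rw [R.U_sub hp'B, R.U_nsmul hp'B, two_nsmul]
    rw [le_sub_iff_add_le] at h
    exact sub_nonpos.2 h
  have h2u0 : (2 : ℕ) • Ut u0 (φ c) ≤ φ u0 := by
    have h := R.U_compl hpB ((2 : ℕ) • φ c - φ q)
    have h3 : Ut u0 ((2 : ℕ) • φ c - φ q) ≤ 0 := by
      rw [h, R.Uadd u0 hu0B, ← hdφ, hUu0d, zero_add]
      exact R.U_nonpos hu0B hneg
    rw [R.U_sub hu0B, R.U_nsmul hu0B, hUq u0 hu0B hu0q] at h3
    exact sub_nonpos.1 h3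
  have hJC := R.C_J hu0B hc
  have h2J : φ (CB.J u0 c) + φ (CB.J u0 c) ≤ φ u0 := by
    rw [← R.UJ u0 hu0B c hc, ← two_nsmul]; exact h2u0
  obtain ⟨e, he⟩ := R.hadd' _ hJC _ hJC (le_trans h2J (R.hmem _ (R.BC hu0B)).2)
  have hee := R.hadd _ hJC _ hJC _ he
  have heC := R.C_add hJC hJC he
  refine ⟨d, s, u0, e, rfl, hcov, by rw [hgu]; exact hmeet, hmeet2, EA.oplusD_eq he, hsB, hu0B, hu0', hdC,
    hdle, h2s, heC, R.le_of_phi heC (R.BC hu0B) (by rw [hee]; exact h2J), ?_⟩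
  rw [hee, ← R.UJ u0 hu0B c hc, two_nsmul]

theorem ucAux_inv (R : Rep EA CB B v φ Ut) {a : E} (ha : a ∈ Cblock EA CB B) (t : List Bool) :
    (ucAux EA CB a t).1 ∈ B ∧ (ucAux EA CB a t).2 ∈ Cblock EA CB B ∧
      EA.le (ucAux EA CB a t).2 (ucAux EA CB a t).1 ∧
      (2 ^ t.length : ℕ) • Ut (ucAux EA CB a t).1 (φ a) =
        nR t • φ (ucAux EA CB a t).1 + φ (ucAux EA CB a t).2 := by
  induction t with
  | nil =>
    have h1 := R.cover_mem ha
    have h2 := R.le_cover a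
    refine ⟨h1, ha, h2, ?_⟩
    simp only [ucAux, nR, List.length_nil, pow_zero, one_nsmul, zero_nsmul, zero_add]
    rw [R.UJ _ h1 a ha, J_of_le CB (R.BP h1) h2]
  | cons b t ih =>
    obtain ⟨hq, hc, hle, heq⟩ := ih
    obtain ⟨d, s, u0, e, h1, h2, h3, h4, h5, hs, hu0, hp, hd, hds, h2s, he, heu, h2u⟩ :=
      R.step hq hc hle
    have hpow : ∀ x ∈ B, EA.le x (ucAux EA CB a t).1 →
        (2 ^ t.length : ℕ) • Ut x (φ a) = nR t • φ x + Ut x (φ (ucAux EA CB a t).2) := by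
      intro x hx hxq
      have := congrArg (Ut x) heq
      rw [R.U_nsmul hx, R.U_of_le hx hq hxq, R.Uadd x hx, R.U_nsmul hx] at this
      rw [this, ← R.U_one hq, R.U_of_le hx hq hxq, R.U_one hx]
    cases b with
    | true =>
      have e : ucAux EA CB a (true :: t) = (s, d) := by
        simp only [ucAux, h1, h2, h3, h4, if_true]
      rw [e]
      refine ⟨hs, hd, hds, ?_⟩
      have h := hpow s hs (EA.le_right hp)
      simp only [List.length_cons, nR, if_true]
      rw [pow_succ, mul_nsmul, h, nsmul_add, h2s, ← mul_nsmul, mul_comm, add_nsmul, one_nsmul]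
      abel
    | false =>
      have e : ucAux EA CB a (false :: t) = (u0, e) := by
        simp [ucAux, h1, h2, h3, h5]
      rw [e]
      refine ⟨hu0, he, heu, ?_⟩
      have h := hpow u0 hu0 (EA.le_left hp)
      simp only [List.length_cons, nR]
      rw [pow_succ, mul_nsmul, h, nsmul_add, h2u, ← mul_nsmul, mul_comm]
      simp

theorem ucAux_split (R : Rep EA CB B v φ Ut) {a : E} (ha : a ∈ Cblock EA CB B) (t : List Bool) :
    EA.padd (ucAux EA CB a (false :: t)).1 (ucAux EA CB a (true :: t)).1 =
      some (ucAux EA CB a t).1 := by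
  obtain ⟨hq, hc, hle, heq⟩ := R.ucAux_inv ha t
  obtain ⟨d, s, u0, e, h1, h2, h3, h4, h5, hs, hu0, hp, -⟩ := R.step hq hc hle
  have e1 : (ucAux EA CB a (true :: t)).1 = s := by
    simp only [ucAux, h1, h2, h3, h4, if_true]
  have e2 : (ucAux EA CB a (false :: t)).1 = u0 := by
    simp [ucAux, h1, h2, h3]
  rw [e1, e2, hp]

end Rep

end EffectAlgebra

namespace EffectAlgebra

theorem sum_filter_split {α G : Type*} [AddCommGroup G] (P : α → Bool) (f : α → G)
    (l : List α) :
    ((l.filter P).map f).sum + ((l.filter fun x => !P x).map f).sum = (l.map f).sum := by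
  induction l with
  | nil => simp
  | cons x l ih =>
    cases h : P x
    · simp only [List.filter_cons, h, List.map_cons, List.sum_cons, ← ih]
      simp
      abel
    · simp only [List.filter_cons, h, List.map_cons, List.sum_cons, ← ih]
      simp
      abel

theorem list_sum_nonpos {G : Type*} [AddCommGroup G] [Lattice G] [IsOrderedAddMonoid G]
    (l : List G) (h : ∀ x ∈ l, x ≤ 0) : l.sum ≤ 0 := by
  induction l with
  | nil => simp
  | cons x l ih =>
    rw [List.sum_cons]
    exact add_nonpos (h x (by simp)) (ih fun y hy => h y (by simp [hy]))

theorem sum_flatMap_split {G : Type*} [AddCommGroup G] (F F' : List Bool → G)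
    (h : ∀ w, F (w ++ [false]) + F (w ++ [true]) = F' w) (L : List (List Bool)) :
    ((L.flatMap fun w => [w ++ [false], w ++ [true]]).map F).sum = (L.map F').sum := by
  induction L with
  | nil => simp
  | cons x L ih =>
    rw [List.flatMap_cons, List.map_append, List.sum_append, ih]
    simp [← h x]

namespace Rep

variable {E : Type u} {EA : EffectAlgebra E} {CB : CompressionBase EA} {B : Set E}
    {G : Type u} [AddCommGroup G] [Lattice G] [IsOrderedAddMonoid G]
    {v : G} {φ : E → G} {Ut : E → G → G}

theorem foldl_sum (R : Rep EA CB B v φ Ut) : ∀ (l : List E) (acc : E), acc ∈ B → (∀ x ∈ l, x ∈ B) →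
    φ acc + (l.map φ).sum ≤ v →
    l.foldl (fun acc x => EA.oplusD acc x) acc ∈ B ∧
      ∀ g, Ut (l.foldl (fun acc x => EA.oplusD acc x) acc) g =
        Ut acc g + (l.map fun x => Ut x g).sum
  | [], acc, hacc, _, _ => by simpa using hacc
  | x :: l, acc, hacc, hl, hle => by
    have hx : x ∈ B := hl x (by simp)
    have hl' : ∀ y ∈ l, y ∈ B := fun y hy => hl y (by simp [hy])
    have hnn : 0 ≤ (l.map φ).sum := by
      apply List.sum_nonneg
      intro y hy
      rw [List.mem_map] at hy
      obtain ⟨z, hz, rfl⟩ := hy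
      exact (R.hmem z (R.BC (hl' z hz))).1
    rw [List.map_cons, List.sum_cons, ← add_assoc] at hle
    obtain ⟨z, hz⟩ := R.hadd' acc (R.BC hacc) x (R.BC hx)
      (le_trans (le_add_of_nonneg_right hnn) hle)
    have hzB := R.B_add hacc hx hz
    have hzφ := R.hadd _ (R.BC hacc) _ (R.BC hx) _ hz
    obtain ⟨h1, h2⟩ := foldl_sum R l z hzB hl' (by rw [hzφ]; exact hle)
    simp only [List.foldl_cons, EA.oplusD_eq hz, List.map_cons, List.sum_cons]
    refine ⟨h1, fun g => ?_⟩
    rw [h2, R.U_padd hacc hx hz, add_assoc]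

theorem uw_split (R : Rep EA CB B v φ Ut) {a : E} (ha : a ∈ Cblock EA CB B) (w : List Bool) (g : G) :
    Ut (uw EA CB a (w ++ [false])) g + Ut (uw EA CB a (w ++ [true])) g =
      Ut (uw EA CB a w) g := by
  unfold uw
  simp only [List.reverse_append, List.reverse_cons, List.reverse_nil, List.nil_append,
    List.cons_append]
  exact (R.U_padd (R.ucAux_inv ha _).1 (R.ucAux_inv ha _).1 (R.ucAux_split ha _) g).symm

theorem sum_all (R : Rep EA CB B v φ Ut) {a : E} (ha : a ∈ Cblock EA CB B) (g : G) (n : ℕ) :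
    ((allStrings n).map fun w => Ut (uw EA CB a w) g).sum = Ut (projCover EA CB a) g := by
  induction n with
  | zero => simp [allStrings, uw, ucAux]
  | succ n ih =>
    rw [allStrings, sum_flatMap_split _ (fun w => Ut (uw EA CB a w) g)
      (fun w => R.uw_split ha w g), ih]

theorem pbin_spec (R : Rep EA CB B v φ Ut) {a : E} (ha : a ∈ Cblock EA CB B) (w : List Bool) :
    pbin EA CB a w ∈ B ∧
      Ut (pbin EA CB a w) ((2 ^ (w.length + 1) : ℕ) • φ a - nR (true :: w.reverse) • v) ≤ 0 ∧
      0 ≤ Ut (EA.compl (pbin EA CB a w))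
        ((2 ^ (w.length + 1) : ℕ) • φ a - nR (true :: w.reverse) • v) := by
  set g := (2 ^ (w.length + 1) : ℕ) • φ a - nR (true :: w.reverse) • v with hg
  have hcB := R.cover_mem ha
  have hcB' := R.B_compl hcB
  have huB : ∀ x, uw EA CB a x ∈ B := fun x => (R.ucAux_inv ha _).1
  have hzB : EA.zero ∈ B := R.mem_B_of_C CB.sub.1 R.C_zero
  -- the two inequalities on each piece
  have hpow : ∀ x : List Bool, x.length = w.length + 1 → Ut (uw EA CB a x) g =
      nR x.reverse • φ (uw EA CB a x) + φ (cw EA CB a x)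
        - nR (true :: w.reverse) • φ (uw EA CB a x) := by
    intro x hx
    have h := (R.ucAux_inv ha x.reverse).2.2.2
    rw [List.length_reverse, hx] at h
    rw [hg, R.U_sub (huB x), R.U_nsmul (huB x), R.U_nsmul (huB x), R.U_one (huB x)]
    unfold uw cw
    rw [h]
  have hcmp : ∀ x : List Bool, x.length = w.length + 1 →
      (lamOf x ≤ lamOf (w ++ [false]) ↔ nR x.reverse + 1 ≤ nR (true :: w.reverse)) := by
    intro x hx
    rw [lamOf_eq x, lamOf_eq (w ++ [false])]
    simp only [List.reverse_append, List.reverse_cons, List.reverse_nil, List.nil_append,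
      List.cons_append, List.length_append, List.length_cons, List.length_nil, hx, zero_add]
    rw [div_le_div_iff_of_pos_right (by positivity)]
    simp only [nR, Nat.cast_le]
    simp
  have hpos : ∀ x, 0 ≤ φ (uw EA CB a x) := fun x => (R.hmem _ (R.BC (huB x))).1
  have hlow : ∀ x : List Bool, x.length = w.length + 1 →
      lamOf x ≤ lamOf (w ++ [false]) → Ut (uw EA CB a x) g ≤ 0 := by
    intro x hx hl
    rw [hpow x hx, sub_nonpos]
    rw [hcmp x hx] at hl
    have h := R.ucAux_inv ha x.reverse
    have h1 : φ (cw EA CB a x) ≤ φ (uw EA CB a x) := R.phi_mono h.2.1 (R.BC h.1) h.2.2.1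
    calc _ ≤ nR x.reverse • φ (uw EA CB a x) + φ (uw EA CB a x) := by gcongr
      _ = (nR x.reverse + 1) • φ (uw EA CB a x) := (succ_nsmul _ _).symm
      _ ≤ _ := nsmul_le_nsmul_left (hpos x) hl
  have hhigh : ∀ x : List Bool, x.length = w.length + 1 →
      ¬ lamOf x ≤ lamOf (w ++ [false]) → 0 ≤ Ut (uw EA CB a x) g := by
    intro x hx hl
    rw [hpow x hx, sub_nonneg]
    rw [hcmp x hx] at hl
    have h := R.ucAux_inv ha x.reverse
    have h1 : 0 ≤ φ (cw EA CB a x) := (R.hmem _ h.2.1).1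
    calc _ ≤ nR x.reverse • φ (uw EA CB a x) := nsmul_le_nsmul_left (hpos x) (by omega)
      _ ≤ _ := le_add_of_nonneg_right h1
  -- the sum
  unfold pbin listSum
  set L := (allStrings (w.length + 1)).filter
        fun x => lamOf x ≤ lamOf (w ++ [false]) with hL
  have hlen := length_allStrings (w.length + 1)
  set L' := (allStrings (w.length + 1)).filter
        fun x => !(lamOf x ≤ lamOf (w ++ [false])) with hL'
  have hsplit : ∀ g : G, (L.map fun x => Ut (uw EA CB a x) g).sum +
      (L'.map fun x => Ut (uw EA CB a x) g).sum = Ut (projCover EA CB a) g := by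
    intro g
    rw [← R.sum_all ha g (w.length + 1), hL, hL']
    exact sum_filter_split _ _ _
  have hmapφ : (L.map fun x => φ (uw EA CB a x)).sum ≤ φ (projCover EA CB a) := by
    have h := hsplit v
    simp only [R.U_one (huB _), R.U_one hcB] at h
    rw [← h]
    apply le_add_of_nonneg_right
    apply List.sum_nonneg
    intro y hy
    rw [List.mem_map] at hy
    obtain ⟨z, hz, rfl⟩ := hy
    exact hpos z
  have hone : φ (EA.compl (projCover EA CB a)) + φ (projCover EA CB a) = v := by
    rw [← R.hadd _ (R.BC hcB') _ (R.BC hcB) _ (EA.compl_spec' _), R.one]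
  obtain ⟨hB1, hU⟩ := R.foldl_sum
    (EA.compl (projCover EA CB a) :: L.map (uw EA CB a)) EA.zero hzB (by
      intro x hx
      rcases List.mem_cons.1 hx with rfl | hx
      · exact hcB'
      · obtain ⟨y, -, rfl⟩ := List.mem_map.1 hx
        exact huB y) (by
      rw [R.phi_zero, zero_add, List.map_cons, List.sum_cons, List.map_map, ← hone]
      exact add_le_add le_rfl hmapφ)
  set p := (EA.compl (projCover EA CB a) :: L.map (uw EA CB a)).foldl
    (fun acc x => EA.oplusD acc x) EA.zero with hp
  have hU0 : ∀ g, Ut EA.zero g = 0 := by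
    intro g
    have h := R.U_padd hzB hzB (EA.padd_zero _) g
    simpa using h
  have hU2 : Ut p g = Ut (EA.compl (projCover EA CB a)) g +
      (L.map fun x => Ut (uw EA CB a x) g).sum := by
    rw [hU, hU0, zero_add, List.map_cons, List.sum_cons, List.map_map]
    rfl
  have hc0 : Ut (EA.compl (projCover EA CB a)) g ≤ 0 := by
    rw [hg, R.U_sub hcB', R.U_nsmul hcB', R.U_nsmul hcB', R.U_one hcB', R.UJ _ hcB' a ha,
      Jc_eq_zero CB (R.BP hcB) (R.le_cover a), R.phi_zero, nsmul_zero, zero_sub]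
    exact neg_nonpos.2 (nsmul_nonneg (R.hmem _ (R.BC hcB')).1 _)
  refine ⟨hB1, ?_, ?_⟩
  · rw [hU2]
    refine add_nonpos hc0 ?_
    apply list_sum_nonpos
    intro y hy
    obtain ⟨x, hx, rfl⟩ := List.mem_map.1 hy
    rw [hL, List.mem_filter] at hx
    exact hlow x (hlen x hx.1) (by simpa using hx.2)
  · have h1 := R.U_compl hB1 g
    have h2 := R.U_compl hcB g
    have h3 : Ut (EA.compl p) g = (L'.map fun x => Ut (uw EA CB a x) g).sum := by
      have h4 : Ut (EA.compl p) g = g - Ut p g := eq_sub_of_add_eq' h1.symm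
      rw [h4, hU2, sub_eq_iff_eq_add]
      refine h2.trans ?_
      rw [← hsplit g]
      abel
    rw [h3]
    apply List.sum_nonneg
    intro y hy
    obtain ⟨x, hx, rfl⟩ := List.mem_map.1 hy
    rw [hL', List.mem_filter] at hx
    exact hhigh x (hlen x hx.1) (by simpa using hx.2)

theorem pdyad_spec (R : Rep EA CB B v φ Ut) {a : E} (ha : a ∈ Cblock EA CB B) {x : ℚ} (hx : Dyadic01 x) (h0 : 0 < x) :
    ∃ k j : ℕ, x = (j : ℚ) / 2 ^ k ∧ pdyad EA CB a x ∈ B ∧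
      Ut (pdyad EA CB a x) ((2 ^ k : ℕ) • φ a - j • v) ≤ 0 ∧
      0 ≤ Ut (EA.compl (pdyad EA CB a x)) ((2 ^ k : ℕ) • φ a - j • v) := by
  obtain ⟨n, k, hk, hxk⟩ := hx
  have h2n : (0 : ℚ) < 2 ^ n := by positivity
  by_cases h1 : 1 ≤ x
  · have hx1 : x = 1 := le_antisymm (by rw [hxk, div_le_one h2n]; exact hk) h1
    have e : pdyad EA CB a x = EA.one := by
      unfold pdyad
      rw [if_neg (not_le.2 h0), if_pos h1]
    rw [e]
    refine ⟨0, 1, by simp [hx1], R.B_one, ?_, ?_⟩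
    · rw [R.U_id]
      simpa using (R.hmem a ha).2
    · have h := R.U_compl R.B_one ((2 ^ 0 : ℕ) • φ a - 1 • v)
      rw [R.U_id] at h
      rw [left_eq_add.1 h]
  · have hex : ∃ w : List Bool, lamOf (w ++ [true]) = x := by
      rw [hxk]
      exact exists_word n k (hxk ▸ h0) (hxk ▸ not_le.1 h1)
    have e : pdyad EA CB a x = pbin EA CB a hex.choose := by
      unfold pdyad
      rw [if_neg (not_le.2 h0), if_neg h1, dif_pos hex]
    rw [e]
    have hw := hex.choose_spec
    generalize hex.choose = w at hw
    refine ⟨w.length + 1, nR (true :: w.reverse), ?_, R.pbin_spec ha w⟩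
    rw [← hw, lamOf_eq]
    simp

/-- multiples in `E` of elements of the C-block -/
theorem nsmulE_exists (R : Rep EA CB B v φ Ut) {x : E} (hx : x ∈ Cblock EA CB B) :
    ∀ N : ℕ, N • φ x ≤ v → ∃ b, EA.nsmulE N x = some b ∧ b ∈ Cblock EA CB B ∧ φ b = N • φ x
  | 0, _ => ⟨EA.zero, rfl, R.C_zero, by rw [R.phi_zero, zero_nsmul]⟩
  | N + 1, h => by
    have h0 := (R.hmem x hx).1
    obtain ⟨b, hb, hbC, hbφ⟩ := nsmulE_exists R hx N
      (le_trans (nsmul_le_nsmul_left h0 (Nat.le_succ N)) h)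
    have e : φ x + φ b = (N + 1) • φ x := by rw [hbφ, succ_nsmul']
    obtain ⟨z, hz⟩ := R.hadd' x hx b hbC (by rw [e]; exact h)
    refine ⟨z, ?_, R.C_add hx hbC hz, by rw [R.hadd _ hx _ hbC _ hz, e]⟩
    simp only [nsmulE, hb]
    exact hz

end Rep

theorem exists_dyadic {m n : ℕ} (hn : 0 < n) (hmn : m < n) (N : ℕ) :
    ∃ μ : ℚ, Dyadic01 μ ∧ (m : ℚ) / n < μ ∧ (N : ℚ) * (n * μ - m) ≤ 1 := by
  have hnq : (0 : ℚ) < n := by exact_mod_cast hn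
  obtain ⟨k, hk⟩ : ∃ k : ℕ, N * n ≤ 2 ^ k := ⟨N * n, (Nat.lt_two_pow_self).le⟩
  have h2 : (0 : ℚ) < 2 ^ k := by positivity
  set j := m * 2 ^ k / n + 1 with hj
  have h1 : m * 2 ^ k < n * j := by
    rw [hj]; exact Nat.lt_mul_div_succ _ hn
  have h3 : n * j ≤ m * 2 ^ k + n := by
    rw [hj, mul_add, mul_one]
    exact Nat.add_le_add_right (Nat.mul_div_le _ _) _
  have h4 : j ≤ 2 ^ k := by
    rw [hj, Nat.succ_le_iff, Nat.div_lt_iff_lt_mul hn, mul_comm]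
    exact Nat.mul_lt_mul_of_pos_left hmn (by positivity)
  have h1q : (m : ℚ) * 2 ^ k < n * j := by exact_mod_cast h1
  have h3q : (n : ℚ) * j ≤ m * 2 ^ k + n := by exact_mod_cast h3
  have hkq : (N : ℚ) * n ≤ 2 ^ k := by exact_mod_cast hk
  refine ⟨(j : ℚ) / 2 ^ k, ⟨k, j, by exact_mod_cast h4, rfl⟩, ?_, ?_⟩
  · rw [div_lt_div_iff₀ hnq h2]; linarith
  · have e : (N : ℚ) * (n * (j / 2 ^ k) - m) = N * (n * j - m * 2 ^ k) / 2 ^ k := by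
      field_simp
    rw [e, div_le_one h2]
    refine le_trans ?_ hkq
    exact mul_le_mul_of_nonneg_left (by linarith) (Nat.cast_nonneg N)

end EffectAlgebra

open EffectAlgebra in
/-- in an archimedean spectral effect algebra, for every `a ∈ E` and
`λ ∈ [0,1] ∩ ℚ`, the rational spectral projection `p^C_{a,λ} = ((n·a − m·u)_+)^*`
(λ = m/n, computed in the universal group of any C-block `C` containing `a`) is the
infimum `⋀{p_{a,μ} : μ dyadic, μ > λ}`; in particular it does not depend on `C`. -/
theorem statement13 {E : Type u} (EA : EffectAlgebra E) (CB : CompressionBase EA)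
    (harch : EA.ArchimedeanEA) (hspec : Spectral EA CB) (a : E)
    (B : Set E) (hB : IsBlock EA CB B) (haC : a ∈ Cblock EA CB B)
    {G : Type u} [AddCommGroup G] [Lattice G] [CovariantClass G G (· + ·) (· ≤ ·)]
    (u : G) (hu : 0 ≤ u ∧ ∀ g : G, ∃ n : ℕ, g ≤ n • u)
    (φ : E → G) (hφ1 : φ EA.one = u)
    (hmem : ∀ x ∈ Cblock EA CB B, 0 ≤ φ x ∧ φ x ≤ u)
    (hinj : ∀ x ∈ Cblock EA CB B, ∀ y ∈ Cblock EA CB B, φ x = φ y → x = y)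
    (hsurj : ∀ g : G, 0 ≤ g → g ≤ u → ∃ x ∈ Cblock EA CB B, φ x = g)
    (hadd : ∀ x ∈ Cblock EA CB B, ∀ y ∈ Cblock EA CB B, ∀ z : E,
      EA.padd x y = some z → φ z = φ x + φ y)
    (hadd' : ∀ x ∈ Cblock EA CB B, ∀ y ∈ Cblock EA CB B, φ x + φ y ≤ u →
      ∃ z : E, EA.padd x y = some z)
    (huniv : ∀ (H : Type u) [AddCommGroup H], ∀ ψ : E → H,
      (∀ x ∈ Cblock EA CB B, ∀ y ∈ Cblock EA CB B, ∀ z : E, EA.padd x y = some z →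
        ψ z = ψ x + ψ y) →
      ∃! h : G → H, (∀ g g' : G, h (g + g') = h g + h g') ∧
        ∀ x ∈ Cblock EA CB B, h (φ x) = ψ x)
    (Ut : E → G → G)
    (hUt : ∀ p ∈ B, (∀ g g' : G, Ut p (g + g') = Ut p g + Ut p g') ∧
      (∀ g g' : G, g ≤ g' → Ut p g ≤ Ut p g') ∧
      ∀ x ∈ Cblock EA CB B, Ut p (φ x) = φ (CB.J p x))
    (rick : G → E)
    (hrick : ∀ g : G, rick g ∈ B ∧ ∀ p ∈ B,
      (EA.le p (rick g) ↔ (g = Ut p g + Ut (EA.compl p) g ∧ Ut p g = 0)))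
    :
    ∀ lam : ℚ, 0 ≤ lam → lam ≤ 1 → ∀ m n : ℕ, 0 < n → lam = (m : ℚ) / (n : ℚ) →
      IsInfP EA CB {y | ∃ μ : ℚ, Dyadic01 μ ∧ lam < μ ∧ y = pdyad EA CB a μ}
        (rick ((n • φ a - m • u) ⊔ 0)) := by
  have : IsOrderedAddMonoid G :=
    { add_le_add_left := fun a b h c => by
        have := add_le_add_right h c
        simpa only [add_comm] using this }
  have R : Rep EA CB B u φ Ut :=
    { hpc := hspec.1
      hbc := hspec.2
      hB := hB
      one := hφ1
      hmem := hmem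
      hinj := hinj
      hsurj := hsurj
      hadd := hadd
      hadd' := hadd'
      ext := by
        intro f g hf hg hfg x
        have h := huniv G (fun x => g (φ x)) (by
          intro x hx y hy z hz
          rw [hadd x hx y hy z hz, hg])
        have := h.unique ⟨hf, hfg⟩ ⟨hg, fun _ _ => rfl⟩
        exact congrFun this x
      Uadd := fun p hp => (hUt p hp).1
      Umono := fun p hp => (hUt p hp).2.1
      UJ := fun p hp => (hUt p hp).2.2 }
  intro lam h0 h1 m n hn hlam
  have hnq : (0 : ℚ) < n := by exact_mod_cast hn
  set h : G := (n • φ a - m • u) ⊔ 0 with hh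
  have hh0 : 0 ≤ h := le_sup_right
  obtain ⟨hrB, hr⟩ := hrick h
  have hrP := R.BP hrB
  have hUr : Ut (rick h) h = 0 := ((hr _ hrB).1 (EA.le_refl' _)).2
  refine ⟨hrP, ?_, ?_⟩
  · rintro y ⟨μ, hμ, hlμ, rfl⟩
    obtain ⟨k, j, hkj, hpB, -, hge⟩ := R.pdyad_spec haC hμ (lt_of_le_of_lt h0 hlμ)
    generalize pdyad EA CB a μ = p at hpB hge
    have hp'B := R.B_compl hpB
    generalize rick h = r at hrB hrP hUr
    have h2k : (0 : ℚ) < 2 ^ k := by positivity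
    have hlt : m * 2 ^ k + 1 ≤ n * j := by
      rw [hlam, hkj, div_lt_div_iff₀ hnq h2k] at hlμ
      have : m * 2 ^ k < j * n := by exact_mod_cast hlμ
      rw [mul_comm n j]
      exact this
    -- both inequalities on the common part
    have i1 : 0 ≤ Ut r (Ut (EA.compl p) ((2 ^ k : ℕ) • φ a - j • u)) := R.U_nonneg hrB hge
    have i2 : Ut r (Ut (EA.compl p) (n • φ a - m • u)) ≤ 0 := by
      rw [R.U_comm hrB hp'B]
      apply R.U_nonpos hp'B
      rw [← hUr]
      exact R.Umono r hrB _ _ le_sup_left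
    rw [R.U_sub hp'B, R.U_sub hrB, R.U_nsmul hp'B, R.U_nsmul hrB, R.U_nsmul hp'B,
      R.U_nsmul hrB, sub_nonneg] at i1
    rw [R.U_sub hp'B, R.U_sub hrB, R.U_nsmul hp'B, R.U_nsmul hrB, R.U_nsmul hp'B,
      R.U_nsmul hrB, sub_nonpos] at i2
    have hx0 : 0 ≤ Ut r (Ut (EA.compl p) u) := R.U_nonneg hrB (R.U_nonneg hp'B hu.1)
    have hxeq : Ut r (Ut (EA.compl p) u) = φ (CB.J r (EA.compl p)) := by
      rw [R.U_one hp'B, R.UJ r hrB _ (R.BC hp'B)]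
    generalize Ut r (Ut (EA.compl p) u) = x at i1 i2 hx0 hxeq
    generalize Ut r (Ut (EA.compl p) (φ a)) = y at i1 i2
    have i3 := nsmul_le_nsmul_right i1 n
    have i4 := nsmul_le_nsmul_right i2 (2 ^ k)
    rw [← mul_nsmul, ← mul_nsmul] at i3 i4
    rw [mul_comm n (2 ^ k)] at i4
    have i5 : (m * 2 ^ k + 1) • x ≤ (m * 2 ^ k) • x :=
      le_trans (nsmul_le_nsmul_left hx0 hlt) (le_trans (by rw [mul_comm n j]; exact i3) i4)
    rw [succ_nsmul] at i5
    have hx : x ≤ 0 := by simpa using i5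
    have hx' : φ (CB.J r (EA.compl p)) = 0 := by rw [← hxeq]; exact le_antisymm hx hx0
    have hz := R.eq_zero_of_phi (R.C_J hrB (R.BC hp'B)) hx'
    rw [J_eq_zero CB hrP] at hz
    have := EA.compl_le hz
    rwa [EA.compl_compl, EA.compl_compl] at this
  · intro t htP ht
    obtain ⟨d, hdC, hdφ⟩ := R.hsurj (h ⊓ u) (le_inf hh0 hu.1) inf_le_right
    have hdB := R.cover_mem hdC
    have hdle := R.le_cover d
    have hcB := R.B_compl hdB
    -- it suffices that `J_t d = 0`
    suffices hJ : CB.J t d = EA.zero by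
      rw [J_eq_zero CB htP] at hJ
      have h2 := EA.le_compl_comm (R.cover_le (compl_mem CB htP) hJ)
      refine EA.le_trans' h2 ((hr _ hcB).2 ⟨R.U_compl hcB h, ?_⟩)
      have h3 : Ut (EA.compl (projCover EA CB d)) (h ⊓ u) = 0 := by
        rw [← hdφ, R.UJ _ hcB d hdC, Jc_eq_zero CB (R.BP hdB) hdle, R.phi_zero]
      obtain ⟨M, hM⟩ := hu.2 h
      have h4 : h ≤ M • (h ⊓ u) := by
        have := inf_nsmul_le hh0 hu.1 M
        rwa [inf_eq_left.2 hM] at this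
      apply le_antisymm
      · have := R.Umono _ hcB _ _ h4
        rwa [R.U_nsmul hcB, h3, nsmul_zero] at this
      · exact R.U_nonneg hcB hh0
    have hmn : m ≤ n := by
      rw [hlam, div_le_one hnq] at h1
      exact_mod_cast h1
    rcases hmn.eq_or_lt with rfl | hmn
    · have e : h = 0 := by
        rw [hh, sup_eq_right, sub_nonpos]
        exact nsmul_le_nsmul_right (R.hmem a haC).2 m
      have : d = EA.zero := R.eq_zero_of_phi hdC (by
        rw [hdφ, e]; exact inf_eq_left.2 hu.1)
      rw [this, J_zero CB htP]
    · apply harch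
      intro N
      obtain ⟨μ, hμ, hlμ, hNμ⟩ := exists_dyadic hn hmn N
      rw [← hlam] at hlμ
      have htp := ht _ ⟨μ, hμ, hlμ, rfl⟩
      obtain ⟨k, j, hkj, hpB, hle, -⟩ := R.pdyad_spec haC hμ (lt_of_le_of_lt h0 hlμ)
      generalize pdyad EA CB a μ = p at htp hpB hle
      have hp'B := R.B_compl hpB
      have h2k : (0 : ℚ) < 2 ^ k := by positivity
      have hNN : N * (n * j) ≤ N * (m * 2 ^ k) + 2 ^ k := by
        have e : (N : ℚ) * (n * μ - m) = (N * (n * j) - N * (m * 2 ^ k)) / 2 ^ k := by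
          rw [hkj]; field_simp
        rw [e, div_le_one h2k] at hNμ
        have : (N : ℚ) * (n * j) ≤ N * (m * 2 ^ k) + 2 ^ k := by linarith
        exact_mod_cast this
      have hJtd : CB.J t d = CB.J t (CB.J p d) := by
        have e := J_add CB htP (hdC p hpB)
        rw [(J_eq_zero CB htP (CB.J (EA.compl p) d)).2, EA.padd_zero] at e
        · exact (Option.some.inj e).symm
        · exact EA.le_trans' (J_le CB (R.BP hp'B) d) (EA.compl_le htp)
      rw [hJtd]
      suffices hN : N • φ (CB.J p d) ≤ u by
        obtain ⟨b, hb, -⟩ := R.nsmulE_exists (R.C_J hpB hdC) N hN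
        exact ⟨_, EA.nsmulE_J (CB.compr t htP).1.1 (J_zero CB htP) _ N b hb⟩
      have hφp0 := (R.hmem p (R.BC hpB)).1
      -- `N • 2^k • U_p h ≤ 2^k • u`
      set g := Ut p (n • φ a - m • u) with hg
      have k1 : φ (CB.J p d) ≤ g ⊔ 0 := by
        rw [← R.UJ p hpB d hdC, hdφ]
        exact le_trans (R.Umono p hpB _ _ inf_le_left) (R.U_sup hpB _)
      have hlt : m * 2 ^ k ≤ n * j := by
        rw [hlam, hkj, div_lt_div_iff₀ hnq h2k] at hlμ
        have : m * 2 ^ k < j * n := by exact_mod_cast hlμ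
        rw [mul_comm n j]
        exact this.le
      obtain ⟨K, hK⟩ := Nat.exists_eq_add_of_le hlt
      have hNK : N * K ≤ 2 ^ k := by
        rw [hK, mul_add] at hNN
        omega
      have k2 : (2 ^ k : ℕ) • g ≤ K • u := by
        rw [R.U_sub hpB, R.U_nsmul hpB, R.U_nsmul hpB, R.U_one hpB, sub_nonpos] at hle
        rw [hg, R.U_sub hpB, R.U_nsmul hpB, R.U_nsmul hpB, R.U_one hpB]
        generalize Ut p (φ a) = y at hle
        have l1 := nsmul_le_nsmul_right hle n
        rw [← mul_nsmul' (φ p), hK, add_nsmul] at l1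
        have l3 : K • φ p ≤ K • u := nsmul_le_nsmul_right (R.hmem p (R.BC hpB)).2 _
        have l4 : (2 ^ k : ℕ) • (n • y - m • φ p) =
            n • ((2 ^ k : ℕ) • y) - (m * 2 ^ k) • φ p := by
          rw [nsmul_sub]
          simp only [← mul_nsmul']
          congr 2 <;> ring
        rw [l4, sub_le_iff_le_add, add_comm]
        exact le_trans l1 (add_le_add le_rfl l3)
      have k3 : N • (g ⊔ 0) ≤ u := by
        have l1 : (2 ^ k : ℕ) • (g ⊔ 0) ≤ K • u := by
          rw [pow_nsmul_sup]
          exact sup_le k2 (nsmul_nonneg hu.1 K)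
        have l2 := nsmul_le_nsmul_right l1 N
        rw [← mul_nsmul' u] at l2
        have l3 := le_trans l2 (nsmul_le_nsmul_left hu.1 hNK)
        rw [← sub_nonneg]
        apply nonneg_of_pow k
        rw [nsmul_sub, sub_nonneg]
        refine le_trans (le_of_eq ?_) l3
        simp only [← mul_nsmul']
        congr 1
        ring
      exact le_trans (nsmul_le_nsmul_right k1 N) k3
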